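/- arXiv:2302.02026 — 2 statements merged into one kernel-verified Lean document; each statement's English description precedes it below -/
import Mathlib

section
/- Let C ⊆ ℝ^n be an unbounded semialgebraic set. Then there exists R₀ > 0 such that for each R ≥ R₀ there exists a homeomorphism h : C \ B_R(0) → Cone_∞(C ∩ S^{n−1}_R) satisfying ‖h(x)‖ = ‖x‖ for all x ∈ C \ B_R(0) (conic structure at infinity of semialgebraic sets). -/
open Filter Set Topology

noncomputable section

section TopDefs

variable {α β : Type*} [TopologicalSpace α] [TopologicalSpace β]

/-- `h` restricts to a homeomorphism from `X` onto `Y` (for the subspace topologies). -/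
def IsHomeoOn (h : α → β) (X : Set α) (Y : Set β) : Prop :=
  Set.BijOn h X Y ∧ ContinuousOn h X ∧
    ∃ g : β → α, (∀ x ∈ X, g (h x) = x) ∧ (∀ y ∈ Y, h (g y) = y) ∧ ContinuousOn g Y

/-- `A` is a topological manifold of dimension `d` (charts onto open subsets of `ℝ^d`). -/
def IsTopManifoldOfDim (A : Set α) (d : ℕ) : Prop :=
  ∀ a ∈ A, ∃ W : Set α, IsOpen W ∧ a ∈ W ∧
    ∃ (U : Set (EuclideanSpace ℝ (Fin d))) (f : α → EuclideanSpace ℝ (Fin d)),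
      IsOpen U ∧ IsHomeoOn f (A ∩ W) U

/-- The model half-space in `ℝ^d`. -/
def halfSpace (d : ℕ) : Set (EuclideanSpace ℝ (Fin d)) :=
  {u | ∀ hd : 0 < d, 0 ≤ u ⟨0, hd⟩}

/-- `A` is a topological manifold with boundary of dimension `d`
(charts onto relatively open subsets of the half-space of `ℝ^d`). -/
def IsTopManifoldWithBoundaryOfDim (A : Set α) (d : ℕ) : Prop :=
  ∀ a ∈ A, ∃ W : Set α, IsOpen W ∧ a ∈ W ∧
    ∃ (V : Set (EuclideanSpace ℝ (Fin d))) (f : α → EuclideanSpace ℝ (Fin d)),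
      IsOpen V ∧ IsHomeoOn f (A ∩ W) (V ∩ halfSpace d)

end TopDefs

section BlowSpherical

variable {E F : Type*} [NormedAddCommGroup E] [NormedSpace ℝ E]
  [NormedAddCommGroup F] [NormedSpace ℝ F]

/-- The inverse of the spherical blow-up at `p`, `x ↦ ((x-p)/‖x-p‖, ‖x-p‖)`. -/
def blowupInv (p x : E) : E × ℝ := (‖x - p‖⁻¹ • (x - p), ‖x - p‖)

/-- The inverse of the spherical blow-up at infinity, `x ↦ (x/‖x‖, 1/‖x‖)`. -/
def blowupInvInf (x : E) : E × ℝ := (‖x‖⁻¹ • x, ‖x‖⁻¹)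

/-- The strict transform of `X` under the spherical blow-up at `p`. -/
def strictTransform (X : Set E) (p : E) : Set (E × ℝ) := closure (blowupInv p '' (X \ {p}))

/-- The strict transform of `X` under the spherical blow-up at infinity. -/
def strictTransformInf (X : Set E) : Set (E × ℝ) := closure (blowupInvInf '' (X \ {0}))

/-- The strict transform at `p ∈ E ∪ {∞}`, where `none` stands for `∞`. -/
def strictTransformO (X : Set E) : Option E → Set (E × ℝ)
  | some p => strictTransform X p
  | none => strictTransformInf X

/-- The boundary of a strict transform: the points with second coordinate `0`. -/
def transformBoundary (T : Set (E × ℝ)) : Set (E × ℝ) := {z ∈ T | z.2 = 0}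

/-- The filter of neighbourhoods of infinity within `X`. -/
def atInftyOn (X : Set E) : Filter E :=
  Filter.comap (fun x : E => ‖x‖) Filter.atTop ⊓ Filter.principal X

/-- `q = lim_{x → p} h(x)` where `p ∈ E ∪ {∞}`, `q ∈ F ∪ {∞}` (`none` stands for `∞`). -/
def BSLimit (h : E → F) (X : Set E) : Option E → Option F → Prop
  | some p, some q => Filter.Tendsto h (nhdsWithin p X) (nhds q)
  | some p, none => Filter.Tendsto (fun x => ‖h x‖) (nhdsWithin p X) Filter.atTop
  | none, some q => Filter.Tendsto h (atInftyOn X) (nhds q)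
  | none, none => Filter.Tendsto (fun x => ‖h x‖) (atInftyOn X) Filter.atTop

/-- The inverse of the spherical blow-up at `p ∈ E ∪ {∞}`. -/
def blowupInvO : Option E → E → E × ℝ
  | some p, x => blowupInv p x
  | none, x => blowupInvInf x

/-- `x` is the center of the spherical blow-up at `p ∈ E ∪ {∞}` (at infinity, the center is `0`). -/
def IsCenter : Option E → E → Prop
  | some p, x => x = p
  | none, x => x = 0

/-- `h` is a blow-spherical homeomorphism from `X` onto `Y` at `p ∈ E ∪ {∞}` (with
`q = lim_{x → p} h(x) ∈ F ∪ {∞}`): `h` is a homeomorphism from `X` onto `Y` and the induced map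
between the strict transforms extends to a homeomorphism `Φ` of the strict transforms. -/
def IsBSHomeoAtO (h : E → F) (X : Set E) (Y : Set F) (po : Option E) (qo : Option F) : Prop :=
  IsHomeoOn h X Y ∧ BSLimit h X po qo ∧
    ∃ Φ : E × ℝ → F × ℝ,
      IsHomeoOn Φ (strictTransformO X po) (strictTransformO Y qo) ∧
      ∀ x ∈ X, ¬ IsCenter po x → ¬ IsCenter qo (h x) →
        Φ (blowupInvO po x) = blowupInvO qo (h x)

/-- `h` is a (global) blow-spherical homeomorphism from `X` onto `Y`: it is a blow-spherical
homeomorphism at every `p ∈ closure X ∪ {∞}`. -/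
def IsBSHomeo (h : E → F) (X : Set E) (Y : Set F) : Prop :=
  IsHomeoOn h X Y ∧
    (∀ p ∈ closure X, ∃ qo : Option F, IsBSHomeoAtO h X Y (some p) qo) ∧
    (∃ qo : Option F, IsBSHomeoAtO h X Y none qo)

/-- `X` and `Y` are blow-spherical homeomorphic at infinity: outside suitable compact sets there
is a homeomorphism which is blow-spherical at `∞`. -/
def BSHomeoAtInfinity (X : Set E) (Y : Set F) : Prop :=
  ∃ (K : Set E) (K' : Set F), IsCompact K ∧ IsCompact K' ∧
    ∃ h : E → F, IsBSHomeoAtO h (X \ K) (Y \ K') none none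

/-- The tangent cone of `X` at `p`. -/
def tangConeAt (X : Set E) (p : E) : Set E :=
  {v | ∃ (x : ℕ → E) (t : ℕ → ℝ), (∀ i, x i ∈ X) ∧ (∀ i, 0 < t i) ∧
    Filter.Tendsto x Filter.atTop (nhds p) ∧
    Filter.Tendsto (fun i => (t i)⁻¹ • (x i - p)) Filter.atTop (nhds v)}

/-- The tangent cone of `X` at infinity. -/
def tangConeInf (X : Set E) : Set E :=
  {v | ∃ (x : ℕ → E) (t : ℕ → ℝ), (∀ i, x i ∈ X) ∧ (∀ i, 0 < t i) ∧
    Filter.Tendsto (fun i => ‖x i‖) Filter.atTop Filter.atTop ∧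
    Filter.Tendsto (fun i => (t i)⁻¹ • x i) Filter.atTop (nhds v)}

/-- The tangent cone of `X` at `p ∈ E ∪ {∞}`. -/
def tangConeO (X : Set E) : Option E → Set E
  | some p => tangConeAt X p
  | none => tangConeInf X

/-- `Cone_∞(A) = {t • a : a ∈ A, t ≥ 1}`. -/
def coneInfSet (A : Set E) : Set E := {y | ∃ a ∈ A, ∃ t : ℝ, 1 ≤ t ∧ y = t • a}

/-- The inner distance on `X`: the infimum of lengths of paths in `X` joining `x` to `y`. -/
def innerDist (X : Set E) (x y : E) : ENNReal :=
  ⨅ (γ : ℝ → E) (_ : ContinuousOn γ (Set.Icc 0 1)) (_ : Set.MapsTo γ (Set.Icc 0 1) X)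
    (_ : γ 0 = x) (_ : γ 1 = y), eVariationOn γ (Set.Icc 0 1)

/-- `X` is Lipschitz normally embedded. -/
def IsLNE (X : Set E) : Prop :=
  ∃ c : ℝ, 1 ≤ c ∧ ∀ x ∈ X, ∀ y ∈ X, innerDist X x y ≤ ENNReal.ofReal (c * ‖x - y‖)

/-- `X` is Lipschitz normally embedded at the point `p`. -/
def IsLNEAt (X : Set E) (p : E) : Prop := ∃ U : Set E, IsOpen U ∧ p ∈ U ∧ IsLNE (X ∩ U)

/-- `X` is Lipschitz normally embedded at infinity. -/
def IsLNEAtInf (X : Set E) : Prop := ∃ K : Set E, IsCompact K ∧ IsLNE (X \ K)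

/-- `X` and `Y` are outer lipeomorphic. -/
def OuterLipeo (X : Set E) (Y : Set F) : Prop :=
  ∃ (h : E → F) (lam : ℝ), 1 ≤ lam ∧ Set.BijOn h X Y ∧
    ∀ x ∈ X, ∀ x' ∈ X, lam⁻¹ * ‖x - x'‖ ≤ ‖h x - h x'‖ ∧ ‖h x - h x'‖ ≤ lam * ‖x - x'‖

/-- `X` and `Y` are outer lipeomorphic at infinity. -/
def OuterLipeoAtInf (X : Set E) (Y : Set F) : Prop :=
  ∃ (K : Set E) (K' : Set F), IsCompact K ∧ IsCompact K' ∧ OuterLipeo (X \ K) (Y \ K')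

/-- The ends of `C` relative to `R`: the connected components of `C \ {‖x‖ ≤ R}`. -/
def endsRel (C : Set E) (R : ℝ) : Set (Set E) :=
  {A | ∃ x ∈ C \ Metric.closedBall 0 R, A = connectedComponentIn (C \ Metric.closedBall 0 R) x}

/-- `X` contains a homeomorphic copy of a nonempty open subset of `ℝ^d`. -/
def HasDimGE (X : Set E) (d : ℕ) : Prop :=
  ∃ (U : Set (EuclideanSpace ℝ (Fin d))) (f : EuclideanSpace ℝ (Fin d) → E),
    IsOpen U ∧ U.Nonempty ∧ f '' U ⊆ X ∧ IsHomeoOn f U (f '' U)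

/-- `X` has (topological) dimension `d`. -/
def HasDim (X : Set E) (d : ℕ) : Prop := HasDimGE X d ∧ ¬ HasDimGE X (d + 1)

/-- `x` is a simple point of the boundary of the strict transform `T`, relative to dimension `d`:
near `x`, the connected components of `T` minus the boundary are `d`-dimensional topological
manifolds, and together with the boundary they are topological manifolds with boundary. -/
def IsSimplePointOf (T : Set (E × ℝ)) (d : ℕ) (x : E × ℝ) : Prop :=
  x ∈ transformBoundary T ∧
    ∃ W : Set (E × ℝ), IsOpen W ∧ x ∈ W ∧
      ∀ y ∈ (T ∩ W) \ transformBoundary T,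
        IsTopManifoldOfDim (connectedComponentIn ((T ∩ W) \ transformBoundary T) y) d ∧
        IsTopManifoldWithBoundaryOfDim
          (connectedComponentIn ((T ∩ W) \ transformBoundary T) y ∪ (transformBoundary T ∩ W)) d

/-- `x` is a simple point of the boundary of the strict transform `T` of the set `X`. -/
def IsSimplePoint (X : Set E) (T : Set (E × ℝ)) (x : E × ℝ) : Prop :=
  ∃ d : ℕ, HasDim X d ∧ IsSimplePointOf T d x

/-- The relative multiplicity: for every sufficiently small open neighbourhood `W` of `x`,
the number of connected components of `(T \ ∂T) ∩ W` whose closure contains `x` equals `k`. -/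
def RelMultAt (T : Set (E × ℝ)) (x : E × ℝ) (k : ℕ) : Prop :=
  ∃ W₀ : Set (E × ℝ), IsOpen W₀ ∧ x ∈ W₀ ∧
    ∀ W : Set (E × ℝ), IsOpen W → x ∈ W → W ⊆ W₀ →
      {C : Set (E × ℝ) |
        (∃ y ∈ (T \ transformBoundary T) ∩ W,
          C = connectedComponentIn ((T \ transformBoundary T) ∩ W) y) ∧
        x ∈ closure C}.ncard = k

/-- The relative multiplicity of the end `A` (at infinity) equals `k`: the relative multiplicity
equals `k` on a dense open subset of the boundary of the strict transform at infinity of `A`. -/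
def EndMult (A : Set E) (k : ℕ) : Prop :=
  ∃ U : Set (E × ℝ), IsOpen U ∧
    transformBoundary (strictTransformInf A) ⊆
      closure (transformBoundary (strictTransformInf A) ∩ U) ∧
    ∀ x ∈ transformBoundary (strictTransformInf A) ∩ U, RelMultAt (strictTransformInf A) x k

end BlowSpherical

section Algebraic

/-- `X ⊆ ℝ^n` is semialgebraic. -/
def IsSemialgebraic {n : ℕ} (X : Set (EuclideanSpace ℝ (Fin n))) : Prop :=
  ∃ (m : ℕ) (P : Fin m → MvPolynomial (Fin n) ℝ) (k : Fin m → ℕ)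
    (Q : (i : Fin m) → Fin (k i) → MvPolynomial (Fin n) ℝ),
    X = ⋃ i, {x | MvPolynomial.eval (fun j => x j) (P i) = 0 ∧
      ∀ l, 0 < MvPolynomial.eval (fun j => x j) (Q i l)}

/-- The map `h` is semialgebraic on `X`: its graph over `X` is a semialgebraic set. -/
def IsSemialgebraicMapOn {n m : ℕ} (h : EuclideanSpace ℝ (Fin n) → EuclideanSpace ℝ (Fin m))
    (X : Set (EuclideanSpace ℝ (Fin n))) : Prop :=
  IsSemialgebraic { z : EuclideanSpace ℝ (Fin (n + m)) |
    ∃ x ∈ X, (∀ i : Fin n, z (Fin.castAdd m i) = x i) ∧ ∀ j : Fin m, z (Fin.natAdd n j) = h x j }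

/-- `γ` is a continuous semialgebraic arc on `(ε, ∞)`. -/
def IsSemialgebraicArc {n : ℕ} (γ : ℝ → EuclideanSpace ℝ (Fin n)) (ε : ℝ) : Prop :=
  ContinuousOn γ (Set.Ioi ε) ∧
  IsSemialgebraic { z : EuclideanSpace ℝ (Fin (1 + n)) |
    ∃ t ∈ Set.Ioi ε, z (Fin.castAdd n 0) = t ∧ ∀ j : Fin n, z (Fin.natAdd 1 j) = γ t j }

/-- `X ⊆ ℂ^n` is a complex algebraic set. -/
def IsComplexAlgebraic {n : ℕ} (X : Set (EuclideanSpace ℂ (Fin n))) : Prop :=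
  ∃ (m : ℕ) (P : Fin m → MvPolynomial (Fin n) ℂ),
    X = {x | ∀ i, MvPolynomial.eval (fun j => x j) (P i) = 0}

/-- `X` is an irreducible complex algebraic set. -/
def IsIrreducibleAlg {n : ℕ} (X : Set (EuclideanSpace ℂ (Fin n))) : Prop :=
  X.Nonempty ∧ IsComplexAlgebraic X ∧
    ∀ A B : Set (EuclideanSpace ℂ (Fin n)),
      IsComplexAlgebraic A → IsComplexAlgebraic B → X = A ∪ B → X = A ∨ X = B

/-- `C` is an irreducible component of `X`: a maximal irreducible algebraic subset of `X`. -/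
def IsIrredComponent {n : ℕ} (C X : Set (EuclideanSpace ℂ (Fin n))) : Prop :=
  IsIrreducibleAlg C ∧ C ⊆ X ∧
    ∀ C' : Set (EuclideanSpace ℂ (Fin n)), IsIrreducibleAlg C' → C' ⊆ X → C ⊆ C' → C = C'

/-- The (Krull) dimension of the algebraic set `C` equals `d`: there is a strictly increasing
chain of `d+1` irreducible algebraic sets ending in `C`, and no such chain of `d+2` sets. -/
def HasAlgDim {n : ℕ} (C : Set (EuclideanSpace ℂ (Fin n))) (d : ℕ) : Prop :=
  (∃ f : Fin (d + 1) → Set (EuclideanSpace ℂ (Fin n)),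
    (∀ i, IsIrreducibleAlg (f i)) ∧ StrictMono f ∧ f (Fin.last d) = C) ∧
  ¬ ∃ f : Fin (d + 2) → Set (EuclideanSpace ℂ (Fin n)),
    (∀ i, IsIrreducibleAlg (f i)) ∧ StrictMono f ∧ f (Fin.last (d + 1)) = C

/-- `X ⊆ ℂ^n` is a complex algebraic curve: a nonempty complex algebraic set all of whose
irreducible components have complex dimension 1. -/
def IsComplexAlgebraicCurve {n : ℕ} (X : Set (EuclideanSpace ℂ (Fin n))) : Prop :=
  IsComplexAlgebraic X ∧ X.Nonempty ∧ ∀ C, IsIrredComponent C X → HasAlgDim C 1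

/-- `X ⊆ ℂ^n` is a pure dimensional complex algebraic set. -/
def IsPureDimComplexAlgebraic {n : ℕ} (X : Set (EuclideanSpace ℂ (Fin n))) : Prop :=
  IsComplexAlgebraic X ∧ X.Nonempty ∧ ∃ d, ∀ C, IsIrredComponent C X → HasAlgDim C d

/-- `S` is a 1-dimensional complex submanifold: locally the image of a holomorphic embedding,
with nowhere-vanishing derivative, of an open subset of `ℂ`. -/
def IsOneDimComplexSubmanifold {n : ℕ} (S : Set (EuclideanSpace ℂ (Fin n))) : Prop :=
  ∀ z ∈ S, ∃ (W : Set (EuclideanSpace ℂ (Fin n))) (V : Set ℂ)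
    (f : ℂ → EuclideanSpace ℂ (Fin n)),
    IsOpen W ∧ z ∈ W ∧ IsOpen V ∧ DifferentiableOn ℂ f V ∧ Set.InjOn f V ∧
    (∀ t ∈ V, derivWithin f V t ≠ 0) ∧ f '' V = S ∩ W

/-- The set of singular points of `X ⊆ ℂ^n`. -/
def SingSet {n : ℕ} (X : Set (EuclideanSpace ℂ (Fin n))) : Set (EuclideanSpace ℂ (Fin n)) :=
  {p ∈ X | ¬ ∃ U : Set (EuclideanSpace ℂ (Fin n)), IsOpen U ∧ p ∈ U ∧
    IsOneDimComplexSubmanifold (X ∩ U)}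

/-- The embedding `ι : ℂ^n → ℙ^n(ℂ)`, `x ↦ [1 : x]`. -/
def projIota {n : ℕ} (x : EuclideanSpace ℂ (Fin n)) : Projectivization ℂ (Fin (n + 1) → ℂ) :=
  Projectivization.mk ℂ (Fin.cons 1 (fun j => x j)) (by
    intro hzero
    have h0 := congrFun hzero 0
    simp at h0)

end Algebraic

namespace ConicStructure

/-! ### Piecewise linear interpolation -/

/-- The piecewise linear function with value `a i` at `i = 0, …, m` and slope one outside
`[0, m]`. -/
def interp (a : ℕ → ℝ) (m : ℕ) (τ : ℝ) : ℝ :=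
  a 0 + min τ 0 + ∑ i ∈ Finset.range m, (a (i + 1) - a i) * max 0 (min 1 (τ - i)) + max 0 (τ - m)

lemma interp_sum_prefix (a : ℕ → ℝ) {m j : ℕ} (hj : j ≤ m) {τ : ℝ} (hτ : (j : ℝ) ≤ τ)
    (hτ' : ∀ i, j + 1 ≤ i → i < m → τ ≤ i) :
    ∑ i ∈ Finset.range m, (a (i + 1) - a i) * max 0 (min 1 (τ - i)) =
      a j - a 0 + if j < m then (a (j + 1) - a j) * max 0 (min 1 (τ - j)) else 0 := by
  have h1 : ∑ i ∈ Finset.range j, (a (i + 1) - a i) * max 0 (min 1 (τ - i)) = a j - a 0 := by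
    rw [← Finset.sum_range_sub]
    refine Finset.sum_congr rfl fun i hi => ?_
    have hi' : ((i + 1 : ℕ) : ℝ) ≤ j := by exact_mod_cast Finset.mem_range.mp hi
    push_cast at hi'
    rw [min_eq_left (by linarith), max_eq_right zero_le_one, mul_one]
  rw [← h1, ← Finset.sum_range_add_sum_Ico _ hj]
  congr 1
  split_ifs with hjm
  · rw [← Finset.add_sum_Ioo_eq_sum_Ico hjm, add_eq_left]
    refine Finset.sum_eq_zero fun i hi => ?_
    rw [Finset.mem_Ioo] at hi
    have := hτ' i hi.1 hi.2
    rw [max_eq_left ((min_le_right _ _).trans (by linarith)), mul_zero]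
  · rw [Finset.Ico_eq_empty_of_le (by omega), Finset.sum_empty]

lemma interp_of_nonpos (a : ℕ → ℝ) (m : ℕ) {τ : ℝ} (hτ : τ ≤ 0) : interp a m τ = a 0 + τ := by
  have hm : (0 : ℝ) ≤ m := m.cast_nonneg
  unfold interp
  rw [min_eq_left hτ, max_eq_left (by linarith), Finset.sum_eq_zero]
  · ring
  · intro i _
    have hi : (0 : ℝ) ≤ i := i.cast_nonneg
    rw [max_eq_left ((min_le_right _ _).trans (by linarith)), mul_zero]

lemma interp_of_mem (a : ℕ → ℝ) {m i : ℕ} (hi : i < m) {τ : ℝ} (h₁ : (i : ℝ) ≤ τ)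
    (h₂ : τ ≤ i + 1) : interp a m τ = a i + (τ - i) * (a (i + 1) - a i) := by
  have hi0 : (0 : ℝ) ≤ i := i.cast_nonneg
  have him : ((i + 1 : ℕ) : ℝ) ≤ m := by exact_mod_cast hi
  push_cast at him
  unfold interp
  rw [interp_sum_prefix a hi.le h₁, if_pos hi, min_eq_right (b := (0 : ℝ)) (by linarith),
    min_eq_right (a := (1 : ℝ)) (by linarith), max_eq_right (b := τ - i) (by linarith),
    max_eq_left (b := τ - m) (by linarith)]
  · ring
  · intro j hj _
    have : ((i + 1 : ℕ) : ℝ) ≤ j := by exact_mod_cast hj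
    push_cast at this
    linarith

lemma interp_of_le (a : ℕ → ℝ) (m : ℕ) {τ : ℝ} (h : (m : ℝ) ≤ τ) :
    interp a m τ = a m + (τ - m) := by
  have hm : (0 : ℝ) ≤ m := m.cast_nonneg
  unfold interp
  rw [interp_sum_prefix a le_rfl h (fun i h1 h2 => absurd h2 (by omega)), if_neg (lt_irrefl m),
    min_eq_right (by linarith), max_eq_right (by linarith)]
  ring

lemma interp_natCast (a : ℕ → ℝ) {m i : ℕ} (hi : i ≤ m) : interp a m i = a i := by
  rcases hi.lt_or_eq with h | rfl
  · rw [interp_of_mem a h le_rfl (by linarith)]; ring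
  · rw [interp_of_le a i le_rfl]; ring

lemma interp_strictMono {a : ℕ → ℝ} {m : ℕ} (ha : ∀ i < m, a i < a (i + 1)) :
    StrictMono (interp a m) := by
  intro τ τ' h
  have hsum : ∀ i ∈ Finset.range m, (a (i + 1) - a i) * max 0 (min 1 (τ - i)) ≤
      (a (i + 1) - a i) * max 0 (min 1 (τ' - i)) := fun i hi =>
    mul_le_mul_of_nonneg_left (by gcongr) (by linarith [ha i (Finset.mem_range.mp hi)])
  have h₁ : min τ 0 ≤ min τ' 0 := by gcongr
  have h₂ : max 0 (τ - m) ≤ max 0 (τ' - m) := by gcongr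
  unfold interp
  rcases lt_or_ge τ 0 with h0 | h0
  · have : min τ 0 < min τ' 0 := by rw [min_eq_left h0.le]; exact lt_min h h0
    linarith [Finset.sum_le_sum hsum]
  rcases le_or_gt (m : ℝ) τ with hm | hm
  · have : max 0 (τ - m) < max 0 (τ' - m) := by
      rw [max_eq_right (by linarith)]; exact lt_max_of_lt_right (by linarith)
    linarith [Finset.sum_le_sum hsum]
  · have hf := Nat.floor_le h0
    have hf' := Nat.lt_floor_add_one τ
    have hfm : ⌊τ⌋₊ < m := (Nat.floor_lt h0).mpr hm
    have : (a (⌊τ⌋₊ + 1) - a ⌊τ⌋₊) * max 0 (min 1 (τ - ⌊τ⌋₊)) <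
        (a (⌊τ⌋₊ + 1) - a ⌊τ⌋₊) * max 0 (min 1 (τ' - ⌊τ⌋₊)) := by
      refine mul_lt_mul_of_pos_left ?_ (by linarith [ha _ hfm])
      rw [min_eq_right (by linarith), max_eq_right (by linarith)]
      exact lt_max_of_lt_right (lt_min (by linarith) (by linarith))
    linarith [Finset.sum_lt_sum hsum ⟨_, Finset.mem_range.mpr hfm, this⟩]

lemma continuous_interp_comp {X : Type*} [TopologicalSpace X] {a : X → ℕ → ℝ} {m : ℕ}
    (ha : ∀ i ≤ m, Continuous fun u => a u i) {τ : X → ℝ} (hτ : Continuous τ) :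
    Continuous fun u => interp (a u) m (τ u) := by
  unfold interp
  have h0 := ha 0 (Nat.zero_le m)
  refine ((h0.add (by fun_prop)).add (continuous_finsetSum _ fun i hi => ?_)).add (by fun_prop)
  have hi := Finset.mem_range.mp hi
  have h1 := ha i hi.le
  have h2 := ha (i + 1) hi
  fun_prop

lemma interp_surjective (a : ℕ → ℝ) (m : ℕ) : Function.Surjective (interp a m) := by
  have hc : Continuous (interp a m) :=
    continuous_interp_comp (a := fun _ => a) (fun _ _ => continuous_const) continuous_id
  refine hc.surjective ?_ ?_
  · refine tendsto_atTop_mono' _ ?_ (tendsto_atTop_add_const_left _ (a m - m) tendsto_id)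
    filter_upwards [eventually_ge_atTop (m : ℝ)] with τ hτ
    rw [interp_of_le a m hτ, id]
    linarith
  · refine tendsto_atBot_mono' _ ?_ (tendsto_atBot_add_const_left _ (a 0) tendsto_id)
    filter_upwards [eventually_le_atBot (0 : ℝ)] with τ hτ
    rw [interp_of_nonpos a m hτ, id]

/-- The `i`-th element of a finite set of reals, in increasing order. -/
def node (Z : Finset ℝ) (i : ℕ) : ℝ := if h : i < Z.card then Z.orderEmbOfFin rfl ⟨i, h⟩ else 0

lemma node_mem {Z : Finset ℝ} {i : ℕ} (h : i < Z.card) : node Z i ∈ Z := by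
  rw [node, dif_pos h]
  exact Z.orderEmbOfFin_mem rfl _

lemma node_lt_node {Z : Finset ℝ} {i j : ℕ} (hij : i < j) (hj : j < Z.card) :
    node Z i < node Z j := by
  rw [node, node, dif_pos (hij.trans hj), dif_pos hj]
  exact (Z.orderEmbOfFin rfl).strictMono hij

lemma node_le_node {Z : Finset ℝ} {i j : ℕ} (hij : i ≤ j) (hj : j < Z.card) :
    node Z i ≤ node Z j := by
  rcases hij.lt_or_eq with h | rfl
  · exact (node_lt_node h hj).le
  · exact le_rfl

lemma exists_node_eq {Z : Finset ℝ} {z : ℝ} (hz : z ∈ Z) : ∃ i < Z.card, node Z i = z := by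
  have : z ∈ Set.range (Z.orderEmbOfFin rfl) := by rw [Z.range_orderEmbOfFin rfl]; exact hz
  obtain ⟨i, hi⟩ := this
  exact ⟨i, i.2, by rw [node, dif_pos i.2]; exact hi⟩

lemma node_unique {Z : Finset ℝ} {f : ℕ → ℝ} (hf : ∀ i < Z.card, f i ∈ Z)
    (hmono : ∀ i j, i < j → j < Z.card → f i < f j) {i : ℕ} (hi : i < Z.card) :
    node Z i = f i := by
  have := Finset.orderEmbOfFin_unique (s := Z) rfl (f := fun i : Fin Z.card => f i)
    (fun x => hf x x.2) (fun x y hxy => hmono x y hxy y.2)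
  rw [node, dif_pos hi, ← this]

/-- The increasing homeomorphism of the line interpolating the elements of `Z`. -/
def nodeInterp (Z : Finset ℝ) : ℝ → ℝ := interp (node Z) (Z.card - 1)

lemma nodeInterp_strictMono (Z : Finset ℝ) : StrictMono (nodeInterp Z) :=
  interp_strictMono fun i hi => node_lt_node (Nat.lt_succ_self i) (by omega)

/-- `nodeInterp` as an order isomorphism. -/
def nodeIso (Z : Finset ℝ) : ℝ ≃o ℝ :=
  (nodeInterp_strictMono Z).orderIsoOfSurjective _ (interp_surjective _ _)

lemma nodeIso_apply (Z : Finset ℝ) (τ : ℝ) : nodeIso Z τ = interp (node Z) (Z.card - 1) τ := rfl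

lemma nodeIso_natCast {Z : Finset ℝ} {i : ℕ} (hi : i < Z.card) : nodeIso Z i = node Z i :=
  interp_natCast _ (by omega)

end ConicStructure

namespace ConicStructure

/-- Exactly the first `c` elements of `Z` lie below `y`, and `y ∉ Z`. -/
def IsCut (Z : Finset ℝ) (y : ℝ) (c : ℕ) : Prop :=
  c ≤ Z.card ∧ (∀ i < c, node Z i < y) ∧ ∀ i, c ≤ i → i < Z.card → y < node Z i

/-- The gap of `A₀` at position `c₀` is `ε`-close to the gap of `A` at position `c`. -/
def GapClose (A₀ : Finset ℝ) (c₀ : ℕ) (A : Finset ℝ) (c : ℕ) (ε : ℝ) : Prop :=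
  (0 < c₀ → 0 < c ∧ |node A (c - 1) - node A₀ (c₀ - 1)| < ε) ∧
  (c₀ < A₀.card → c < A.card ∧ |node A c - node A₀ c₀| < ε) ∧
  (c₀ = 0 → c = 0) ∧ (c₀ = A₀.card → c = A.card)

/-- Two finite sets are at Hausdorff distance less than `ε`. -/
def HClose (A₀ A : Finset ℝ) (ε : ℝ) : Prop :=
  (∀ a ∈ A₀, ∃ b ∈ A, |b - a| < ε) ∧ ∀ b ∈ A, ∃ a ∈ A₀, |b - a| < ε

lemma exists_label_cut (k : ℕ) {τ : ℝ} (hτ : ∀ i < k, τ ≠ i) :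
    ∃ c ≤ k, (∀ i < c, (i : ℝ) < τ) ∧ ∀ i, c ≤ i → i < k → τ < i := by
  refine ⟨min k ⌈τ⌉₊, min_le_left _ _, fun i hi => Nat.lt_ceil.mp (hi.trans_le (min_le_right _ _)),
    fun i hi hik => lt_of_le_of_ne ?_ (hτ i hik)⟩
  rcases min_le_iff.mp hi with h | h
  · omega
  · exact Nat.ceil_le.mp h

lemma isCut_nodeIso {Z : Finset ℝ} {τ : ℝ} {c : ℕ} (hc : c ≤ Z.card) (h₁ : ∀ i < c, (i : ℝ) < τ)
    (h₂ : ∀ i, c ≤ i → i < Z.card → τ < i) : IsCut Z (nodeIso Z τ) c := by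
  refine ⟨hc, fun i hi => ?_, fun i hi hi' => ?_⟩
  · rw [← nodeIso_natCast (hi.trans_le hc)]
    exact (nodeIso Z).strictMono (h₁ i hi)
  · rw [← nodeIso_natCast hi']
    exact (nodeIso Z).strictMono (h₂ i hi hi')

lemma gapClose_of_hClose {A₀ A : Finset ℝ} {ε y₀ y : ℝ} {c₀ c : ℕ} (h : HClose A₀ A ε)
    (hc₀ : IsCut A₀ y₀ c₀) (hc : IsCut A y c) (hgap : ∀ a ∈ A₀, 3 * ε ≤ |a - y₀|)
    (hy : |y - y₀| < ε) : GapClose A₀ c₀ A c ε := by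
  have hy' := abs_lt.mp hy
  have hε : 0 < ε := (abs_nonneg _).trans_lt hy
  have below : 0 < c → 0 < c₀ ∧ node A (c - 1) < node A₀ (c₀ - 1) + ε := by
    intro h0
    have hmem : node A (c - 1) ∈ A := node_mem (by have := hc.1; omega)
    have hlt := hc.2.1 (c - 1) (by omega)
    obtain ⟨a, ha, hba⟩ := h.2 _ hmem
    have hba' := abs_lt.mp hba
    obtain ⟨i, hi, rfl⟩ := exists_node_eq ha
    have hic : i < c₀ := by
      by_contra hcon
      have h1 := hc₀.2.2 i (by omega) hi
      have h2 := hgap _ ha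
      rw [abs_of_pos (by linarith)] at h2
      linarith
    have := node_le_node (Z := A₀) (i := i) (j := c₀ - 1) (by omega) (by have := hc₀.1; omega)
    exact ⟨by omega, by linarith⟩
  have above : c < A.card → c₀ < A₀.card ∧ node A₀ c₀ - ε < node A c := by
    intro h0
    have hmem : node A c ∈ A := node_mem h0
    have hlt := hc.2.2 c le_rfl h0
    obtain ⟨a, ha, hba⟩ := h.2 _ hmem
    have hba' := abs_lt.mp hba
    obtain ⟨i, hi, rfl⟩ := exists_node_eq ha
    have hic : c₀ ≤ i := by
      by_contra hcon
      have h1 := hc₀.2.1 i (by omega)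
      have h2 := hgap _ ha
      rw [abs_of_neg (by linarith)] at h2
      linarith
    have := node_le_node (Z := A₀) hic hi
    exact ⟨by omega, by linarith⟩
  refine ⟨fun h0 => ?_, fun h0 => ?_, fun h0 => ?_, fun h0 => ?_⟩
  · have hmem : node A₀ (c₀ - 1) ∈ A₀ := node_mem (by have := hc₀.1; omega)
    have hlt := hc₀.2.1 (c₀ - 1) (by omega)
    have h2 := hgap _ hmem
    rw [abs_of_neg (by linarith)] at h2
    obtain ⟨b, hb, hba⟩ := h.1 _ hmem
    have hba' := abs_lt.mp hba
    obtain ⟨i, hi, rfl⟩ := exists_node_eq hb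
    have hic : i < c := by
      by_contra hcon
      have h1 := hc.2.2 i (by omega) hi
      linarith
    have h3 := node_le_node (Z := A) (i := i) (j := c - 1) (by omega) (by have := hc.1; omega)
    have h4 := (below (by omega)).2
    exact ⟨by omega, abs_lt.mpr ⟨by linarith, by linarith⟩⟩
  · have hmem : node A₀ c₀ ∈ A₀ := node_mem h0
    have hlt := hc₀.2.2 c₀ le_rfl h0
    have h2 := hgap _ hmem
    rw [abs_of_pos (by linarith)] at h2
    obtain ⟨b, hb, hba⟩ := h.1 _ hmem
    have hba' := abs_lt.mp hba
    obtain ⟨i, hi, rfl⟩ := exists_node_eq hb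
    have hic : c ≤ i := by
      by_contra hcon
      have h1 := hc.2.1 i (by omega)
      linarith
    have h3 := node_le_node (Z := A) hic hi
    have h4 := (above (by omega)).2
    exact ⟨by omega, abs_lt.mpr ⟨by linarith, by linarith⟩⟩
  · by_contra hcon
    have := (below (by omega)).1
    omega
  · by_contra hcon
    have := (above (lt_of_le_of_ne hc.1 hcon)).1
    omega

lemma GapClose.abs_nodeIso_sub_lt {A₀ A : Finset ℝ} {c₀ c : ℕ} {ε : ℝ} (h : GapClose A₀ c₀ A c ε)
    (hA₀ : A₀.Nonempty) (hc₀ : c₀ ≤ A₀.card) {τ : ℝ} (h₁ : ∀ i < c₀, (i : ℝ) < τ)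
    (h₂ : ∀ i, c₀ ≤ i → i < A₀.card → τ < i) :
    |nodeIso A (τ + (c - c₀)) - nodeIso A₀ τ| < ε := by
  obtain ⟨hlow, hupp, hbot, htop⟩ := h
  have hk := hA₀.card_pos
  simp only [nodeIso_apply]
  rcases Nat.eq_zero_or_pos c₀ with h0 | h0
  · obtain rfl := h0
    obtain rfl := hbot rfl
    have hτ := (h₂ 0 le_rfl hk).le
    simp only [Nat.cast_zero] at hτ
    simp only [sub_self, add_zero]
    rw [interp_of_nonpos _ _ hτ, interp_of_nonpos _ _ hτ, add_sub_add_right_eq_sub]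
    exact (hupp hk).2
  obtain ⟨i, rfl⟩ : ∃ i, c₀ = i + 1 := ⟨c₀ - 1, by omega⟩
  obtain ⟨hc, hlow⟩ := hlow h0
  obtain ⟨j, rfl⟩ : ∃ j, c = j + 1 := ⟨c - 1, by omega⟩
  have hτ := h₁ i (by omega)
  simp only [Nat.add_sub_cancel] at hlow
  push_cast
  rcases hc₀.lt_or_eq with hlt | heq
  · obtain ⟨hlt', hupp⟩ := hupp hlt
    have hτ' := h₂ (i + 1) le_rfl hlt
    push_cast at hτ'
    rw [interp_of_mem (node A₀) (i := i) (by omega) (by linarith) (by linarith),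
      interp_of_mem (node A) (i := j) (by omega) (by linarith) (by linarith)]
    rw [abs_lt] at *
    set l := τ - i with hl
    have e : τ + ((j : ℝ) + 1 - (i + 1)) - j = l := by rw [hl]; ring
    rw [e]
    have hl0 : 0 < l := by linarith
    have hl1 : l < 1 := by linarith
    constructor <;> nlinarith
  · have htop := htop heq
    have e1 : A₀.card - 1 = i := by omega
    have e2 : A.card - 1 = j := by omega
    rw [e1, e2, interp_of_le _ _ hτ.le, interp_of_le _ _ (by linarith)]
    convert hlow using 2
    ring

end ConicStructure

namespace ConicStructure

open Polynomial

/-- A family of nonzero real polynomials of constant degree with continuous coefficients. -/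
structure ContPoly {B : Type*} [TopologicalSpace B] (q : B → ℝ[X]) : Prop where
  cont : ∀ m, Continuous fun w => (q w).coeff m
  deg : ∃ d, ∀ w, (q w).natDegree = d
  ne : ∀ w, q w ≠ 0

section RootContinuity

variable {B : Type*} [TopologicalSpace B]

lemma ContPoly.comp {B' : Type*} [TopologicalSpace B'] {q : B → ℝ[X]} (h : ContPoly q)
    {f : B' → B} (hf : Continuous f) : ContPoly fun w => q (f w) :=
  ⟨fun m => (h.cont m).comp hf, h.deg.imp fun _ hd w => hd (f w), fun w => h.ne (f w)⟩

lemma contPoly_const {r : ℝ[X]} (hr : r ≠ 0) : ContPoly fun _ : B => r :=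
  ⟨fun _ => continuous_const, ⟨_, fun _ => rfl⟩, fun _ => hr⟩

lemma ContPoly.continuous_eval {q : B → ℝ[X]} (h : ContPoly q) :
    Continuous fun z : B × ℝ => (q z.1).eval z.2 := by
  obtain ⟨d, hd⟩ := h.deg
  have : (fun z : B × ℝ => (q z.1).eval z.2) =
      fun z => ∑ i ∈ Finset.range (d + 1), (q z.1).coeff i * z.2 ^ i := by
    ext z
    exact eval_eq_sum_range' (by rw [hd]; exact Nat.lt_succ_self d) _
  rw [this]
  exact continuous_finsetSum _ fun i _ =>
    ((h.cont i).comp continuous_fst).mul (continuous_snd.pow i)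

lemma ContPoly.continuous_aeval {q : B → ℝ[X]} (h : ContPoly q) :
    Continuous fun z : B × ℂ => aeval z.2 (q z.1) := by
  obtain ⟨d, hd⟩ := h.deg
  have : (fun z : B × ℂ => aeval z.2 (q z.1)) =
      fun z => ∑ i ∈ Finset.range (d + 1), (q z.1).coeff i • z.2 ^ i := by
    ext z
    exact aeval_eq_sum_range' (by rw [hd]; exact Nat.lt_succ_self d) _
  rw [this]
  exact continuous_finsetSum _ fun i _ =>
    ((h.cont i).comp continuous_fst).smul (continuous_snd.pow i)

lemma exists_root_of_norm_aeval_lt {r : ℝ[X]} {z₀ : ℂ} {ε : ℝ} (hε : 0 < ε)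
    (h : ‖aeval z₀ r‖ < |r.leadingCoeff| * ε ^ r.natDegree) :
    ∃ z, aeval z r = 0 ∧ ‖z - z₀‖ < ε := by
  by_contra! hcon
  refine h.not_ge ?_
  have hr : r ≠ 0 := by
    rintro rfl
    simp at h
  have hr' : r.map (algebraMap ℝ ℂ) ≠ 0 := (map_ne_zero (f := algebraMap ℝ ℂ) hr)
  have hs : (r.map (algebraMap ℝ ℂ)).Splits := IsAlgClosed.splits _
  rw [← eval_map_algebraMap, hs.eval_eq_prod_roots, norm_mul, leadingCoeff_map]
  have hl : ‖(algebraMap ℝ ℂ) r.leadingCoeff‖ = |r.leadingCoeff| := by simp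
  rw [hl]
  refine mul_le_mul_of_nonneg_left ?_ (abs_nonneg _)
  have hcard : Multiset.card (r.map (algebraMap ℝ ℂ)).roots = r.natDegree := by
    rw [← hs.natDegree_eq_card_roots, natDegree_map]
  rw [← hcard]
  have hmem : ∀ z ∈ (r.map (algebraMap ℝ ℂ)).roots, ε ≤ ‖z₀ - z‖ := by
    intro z hz
    rw [norm_sub_rev]
    apply hcon
    rw [← eval_map_algebraMap]
    exact (mem_roots'.mp hz).2
  generalize (r.map (algebraMap ℝ ℂ)).roots = m at hmem
  induction m using Multiset.induction with
  | empty => simp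
  | cons a s ih =>
    simp only [Multiset.card_cons, Multiset.map_cons, Multiset.prod_cons, norm_mul]
    rw [pow_succ']
    exact mul_le_mul (hmem a (by simp)) (ih fun z hz => hmem z (by simp [hz])) (by positivity)
      (norm_nonneg _)

lemma ContPoly.eventually_exists_aroot {q : B → ℝ[X]} (h : ContPoly q) {w₀ : B} {z₀ : ℂ}
    (hz : aeval z₀ (q w₀) = 0) {U : Set ℂ} (hU : U ∈ 𝓝 z₀) :
    ∀ᶠ w in 𝓝 w₀, ∃ z ∈ U, aeval z (q w) = 0 := by
  obtain ⟨ε, hε, hball⟩ := Metric.mem_nhds_iff.mp hU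
  obtain ⟨d, hd⟩ := h.deg
  have h1 : Continuous fun w => ‖aeval z₀ (q w)‖ :=
    (h.continuous_aeval.comp (continuous_id.prodMk continuous_const)).norm
  have h2 : Continuous fun w => |(q w).coeff d| * ε ^ d := (h.cont d).abs.mul continuous_const
  have h3 : ‖aeval z₀ (q w₀)‖ < |(q w₀).coeff d| * ε ^ d := by
    rw [hz, norm_zero]
    have : (q w₀).coeff d ≠ 0 := by
      have := leadingCoeff_ne_zero.mpr (h.ne w₀)
      rwa [leadingCoeff, hd] at this
    positivity
  filter_upwards [h1.continuousAt.eventually_lt h2.continuousAt h3] with w hw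
  obtain ⟨z, hz, hzz⟩ := exists_root_of_norm_aeval_lt hε
    (show _ < |(q w).leadingCoeff| * ε ^ (q w).natDegree by rwa [leadingCoeff, hd])
  exact ⟨z, hball (by rwa [Metric.mem_ball, dist_eq_norm]), hz⟩

/-- A finite family of `ContPoly` which is closed under differentiation. -/
structure RootFamily {ι : Type*} (p : ι → B → ℝ[X]) : Prop where
  contPoly : ∀ i, ContPoly (p i)
  deriv : ∀ i, (∀ w, (p i w).natDegree = 0) ∨ ∃ j, ∀ w, p j w = derivative (p i w)

variable {ι : Type*} {p : ι → B → ℝ[X]}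

lemma RootFamily.comp (h : RootFamily p) {B' : Type*} [TopologicalSpace B'] {f : B' → B}
    (hf : Continuous f) : RootFamily fun i w => p i (f w) :=
  ⟨fun i => (h.contPoly i).comp hf, fun i => (h.deriv i).imp (fun h w => h (f w))
    fun ⟨j, hj⟩ => ⟨j, fun w => hj (f w)⟩⟩

lemma RootFamily.eventually_exists_root (h : RootFamily p) {w₀ : B} {y₀ : ℝ} {U : Set ℝ}
    (hU : U ∈ 𝓝 y₀) {i : ι} (hi : (p i w₀).eval y₀ = 0) :
    ∀ᶠ w in 𝓝 w₀, ∃ y ∈ U, ∃ j, (p j w).eval y = 0 := by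
  obtain ⟨d, hd⟩ : ∃ d, (p i w₀).natDegree = d := ⟨_, rfl⟩
  induction d using Nat.strong_induction_on generalizing i with
  | _ d ih =>
  rcases h.deriv i with h0 | ⟨j, hj⟩
  · exfalso
    have := (h.contPoly i).ne w₀
    rw [eq_C_of_natDegree_eq_zero (h0 w₀)] at hi this
    simp at hi this
    exact this hi
  have hder := hj w₀
  have hd0 : d ≠ 0 := by
    rintro rfl
    apply (h.contPoly j).ne w₀
    rw [hder, eq_C_of_natDegree_eq_zero hd, derivative_C]
  by_cases hs : (p j w₀).eval y₀ = 0
  · refine ih _ ?_ hs rfl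
    rw [hder, ← hd]
    exact natDegree_derivative_lt (by rw [hd]; exact hd0)
  set c := (p j w₀).eval y₀ with hc
  have hderiv : HasDerivAt (fun y => c * (p i w₀).eval y) (c * c) y₀ := by
    have := ((p i w₀).hasDerivAt y₀).const_mul c
    rwa [← hder] at this
  have hsign := eventually_nhdsWithin_sign_eq_of_deriv_pos
    (f := fun y => c * (p i w₀).eval y) (x₀ := y₀) (by
      rw [hderiv.deriv]; exact mul_self_pos.mpr hs) (by simp [hi])
  obtain ⟨ε, hε, hball⟩ := Metric.mem_nhds_iff.mp (inter_mem hU hsign)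
  have hmem : ∀ y, |y - y₀| < ε → y ∈ U ∧ SignType.sign (c * (p i w₀).eval y) =
      SignType.sign (y - y₀) := fun y hy => hball (by rwa [Metric.mem_ball, Real.dist_eq])
  have ha := (hmem (y₀ - ε / 2) (by rw [abs_lt]; constructor <;> linarith)).2
  have hb := (hmem (y₀ + ε / 2) (by rw [abs_lt]; constructor <;> linarith)).2
  rw [sign_neg (show y₀ - ε / 2 - y₀ < 0 by linarith), sign_eq_neg_one_iff] at ha
  rw [sign_pos (show 0 < y₀ + ε / 2 - y₀ by linarith), sign_eq_one_iff] at hb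
  have hcont : ∀ y, Continuous fun w => c * (p i w).eval y := fun y =>
    continuous_const.mul ((h.contPoly i).continuous_eval.comp
      (continuous_id.prodMk continuous_const))
  filter_upwards [(hcont (y₀ - ε / 2)).continuousAt.eventually_lt continuousAt_const ha,
    continuousAt_const.eventually_lt (hcont (y₀ + ε / 2)).continuousAt hb] with w hwa hwb
  have hivt := intermediate_value_Icc (f := fun y => c * (p i w).eval y)
    (show y₀ - ε / 2 ≤ y₀ + ε / 2 by linarith)
    (continuous_const.mul (p i w).continuous).continuousOn
  obtain ⟨y, hy, hy0⟩ := hivt ⟨hwa.le, hwb.le⟩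
  refine ⟨y, (hmem y ?_).1, i, ?_⟩
  · rw [abs_lt]; constructor <;> linarith [hy.1, hy.2]
  · exact (mul_eq_zero.mp hy0).resolve_left hs

lemma ContPoly.eventually_root_lt {q : B → ℝ[X]} (h : ContPoly q) (w₀ : B) :
    ∃ M : ℝ, ∀ᶠ w in 𝓝 w₀, ∀ y, (q w).eval y = 0 → |y| < M := by
  obtain ⟨d, hd⟩ := h.deg
  set b : B → ℝ := fun w => (∑ i ∈ Finset.range d, |(q w).coeff i|) / |(q w).coeff d| + 1 with hb
  have hlead : ∀ w, (q w).coeff d ≠ 0 := fun w => by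
    have := leadingCoeff_ne_zero.mpr (h.ne w)
    rwa [leadingCoeff, hd] at this
  have hbc : Continuous b := by
    refine Continuous.add (Continuous.div ?_ (h.cont d).abs fun w => abs_ne_zero.mpr (hlead w))
      continuous_const
    exact continuous_finsetSum _ fun i _ => (h.cont i).abs
  refine ⟨b w₀ + 1, ?_⟩
  filter_upwards [hbc.continuousAt.eventually_lt continuousAt_const (lt_add_one (b w₀))]
    with w hw y hy
  refine lt_of_le_of_lt ?_ hw
  have := (IsRoot.norm_lt_cauchyBound (h.ne w) hy).le
  have h2 : (cauchyBound (q w) : ℝ) ≤ b w := by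
    rw [cauchyBound, hd, leadingCoeff, hd]
    push_cast
    simp only [hb, Real.norm_eq_abs]
    gcongr
    have : Finset.sup (Finset.range d) (fun x => ‖(q w).coeff x‖₊) ≤
        ∑ i ∈ Finset.range d, ‖(q w).coeff i‖₊ :=
      Finset.sup_le fun i hi => Finset.single_le_sum (f := fun i => ‖(q w).coeff i‖₊)
        (fun _ _ => zero_le) hi
    have h3 := NNReal.coe_le_coe.mpr this
    push_cast at h3
    simpa using h3
  exact le_trans (by simpa using NNReal.coe_le_coe.mpr this) h2

end RootContinuity

end ConicStructure

namespace ConicStructure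

open Polynomial

section RootSets

variable {B ι : Type*} [Fintype ι]

/-- The real roots of the members of a finite family of polynomials. -/
def realRoots (p : ι → B → ℝ[X]) (w : B) : Finset ℝ := (∏ i, p i w).roots.toFinset

/-- The complex roots of the members of a finite family of real polynomials. -/
def complexRoots (p : ι → B → ℝ[X]) (w : B) : Finset ℂ := ((∏ i, p i w).aroots ℂ).toFinset

variable {p : ι → B → ℝ[X]}

lemma mem_realRoots {w : B} (h : ∀ i, p i w ≠ 0) {y : ℝ} :
    y ∈ realRoots p w ↔ ∃ i, (p i w).eval y = 0 := by
  simp [realRoots, eval_prod, Finset.prod_eq_zero_iff, h]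

lemma mem_complexRoots {w : B} (h : ∀ i, p i w ≠ 0) {z : ℂ} :
    z ∈ complexRoots p w ↔ ∃ i, aeval z (p i w) = 0 := by
  have : ∏ i, p i w ≠ 0 := Finset.prod_ne_zero_iff.mpr fun i _ => h i
  rw [complexRoots, Multiset.mem_toFinset, mem_aroots]
  simp [map_prod, Finset.prod_eq_zero_iff, h]

lemma aeval_ofReal_eq_zero {q : ℝ[X]} {y : ℝ} : aeval (y : ℂ) q = 0 ↔ q.eval y = 0 := by
  have : aeval (y : ℂ) q = ((q.eval y : ℝ) : ℂ) := by
    have := aeval_algebraMap_apply ℂ y q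
    simpa using this
  rw [this, Complex.ofReal_eq_zero]

lemma card_complexRoots_eq (p : ι → B → ℝ[X]) (q : ℝ[X]) (w : B) (h : ∀ i, p i w ≠ 0) :
    (complexRoots p w).card = ((realRoots p w).filter fun y => q.eval y ≠ 0).card +
      ((complexRoots p w).filter fun z => z.im ≠ 0 ∧ aeval z q ≠ 0).card +
      ((complexRoots p w).filter fun z => aeval z q = 0).card := by
  have h1 := Finset.card_filter_add_card_filter_not (s := complexRoots p w)
    (fun z => aeval z q = 0)
  have h2 := Finset.card_filter_add_card_filter_not
    (s := (complexRoots p w).filter fun z => ¬ aeval z q = 0) (fun z => z.im = 0)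
  have h3 : ((realRoots p w).filter fun y => q.eval y ≠ 0).card =
      (((complexRoots p w).filter fun z => ¬ aeval z q = 0).filter fun z => z.im = 0).card := by
    refine Finset.card_bij (fun y _ => (y : ℂ)) ?_ ?_ ?_
    · intro y hy
      rw [Finset.mem_filter, mem_realRoots h] at hy
      simp only [Finset.mem_filter, mem_complexRoots h, aeval_ofReal_eq_zero, Complex.ofReal_im]
      exact ⟨hy, trivial⟩
    · intro a _ b _ hab
      exact Complex.ofReal_injective hab
    · intro z hz
      simp only [Finset.mem_filter, mem_complexRoots h] at hz
      obtain ⟨⟨hz1, hz2⟩, hz3⟩ := hz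
      have hz' : z = (z.re : ℂ) := Complex.ext rfl (by simpa using hz3)
      refine ⟨z.re, ?_, hz'.symm⟩
      rw [hz'] at hz1 hz2
      simp only [aeval_ofReal_eq_zero] at hz1 hz2
      rw [Finset.mem_filter, mem_realRoots h]
      exact ⟨hz1, hz2⟩
  have h4 : ((complexRoots p w).filter fun z => z.im ≠ 0 ∧ aeval z q ≠ 0) =
      (((complexRoots p w).filter fun z => ¬ aeval z q = 0).filter fun z => ¬ z.im = 0) := by
    rw [Finset.filter_filter]
    exact Finset.filter_congr fun z _ => and_comm
  rw [h3, h4]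
  omega

end RootSets

section Local

variable {B ι : Type*} [Fintype ι] [TopologicalSpace B] {p : ι → B → ℝ[X]}

lemma RootFamily.mem_realRoots (h : RootFamily p) {w : B} {y : ℝ} :
    y ∈ realRoots p w ↔ ∃ i, (p i w).eval y = 0 :=
  ConicStructure.mem_realRoots fun i => (h.contPoly i).ne w

lemma RootFamily.mem_complexRoots (h : RootFamily p) {w : B} {z : ℂ} :
    z ∈ complexRoots p w ↔ ∃ i, aeval z (p i w) = 0 :=
  ConicStructure.mem_complexRoots fun i => (h.contPoly i).ne w

/-- The real roots of the family depend continuously on the parameter. -/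
lemma RootFamily.eventually_hClose (h : RootFamily p) (w₀ : B) {ε : ℝ} (hε : 0 < ε) :
    ∀ᶠ w in 𝓝 w₀, HClose (realRoots p w₀) (realRoots p w) ε := by
  refine Filter.Eventually.and ?_ ?_
  · rw [Filter.eventually_all_finset]
    intro a ha
    obtain ⟨i, hi⟩ := h.mem_realRoots.mp ha
    filter_upwards [h.eventually_exists_root (Metric.ball_mem_nhds a hε) hi] with w ⟨y, hy, j, hj⟩
    exact ⟨y, h.mem_realRoots.mpr ⟨j, hj⟩, by rwa [Metric.mem_ball, Real.dist_eq] at hy⟩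
  · have key : ∀ i, ∀ᶠ w in 𝓝 w₀, ∀ y, (p i w).eval y = 0 → ∃ a ∈ realRoots p w₀, |y - a| < ε := by
      intro i
      obtain ⟨M, hM⟩ := (h.contPoly i).eventually_root_lt w₀
      have := (isCompact_Icc (a := -M) (b := M)).eventually_forall_of_forall_eventually
        (x₀ := w₀) (P := fun w y => (p i w).eval y = 0 → ∃ a ∈ realRoots p w₀, |y - a| < ε) (by
        intro y _
        by_cases hy : (p i w₀).eval y = 0
        · have : ∀ᶠ z : B × ℝ in 𝓝 (w₀, y), |z.2 - y| < ε := by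
            have : ContinuousAt (fun z : B × ℝ => |z.2 - y|) (w₀, y) := by fun_prop
            exact this.eventually_lt continuousAt_const (by simpa using hε)
          filter_upwards [this] with z hz _
          exact ⟨y, h.mem_realRoots.mpr ⟨i, hy⟩, hz⟩
        · filter_upwards [(h.contPoly i).continuous_eval.continuousAt.eventually_ne
            (x := (w₀, y)) hy] with z hz hz'
          exact absurd hz' hz)
      filter_upwards [this, hM] with w hw hMw y hy
      exact hw y (abs_le.mp (hMw y hy).le) hy
    filter_upwards [Filter.eventually_all.mpr key] with w hw b hb
    obtain ⟨i, hi⟩ := h.mem_realRoots.mp hb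
    exact hw i b hi

lemma eventually_card_le {X : Type*} [TopologicalSpace X] [T2Space X] {S : B → Finset X} {w₀ : B}
    (h : ∀ z ∈ S w₀, ∀ U ∈ 𝓝 z, ∀ᶠ w in 𝓝 w₀, ∃ z' ∈ S w, z' ∈ U) :
    ∀ᶠ w in 𝓝 w₀, (S w₀).card ≤ (S w).card := by
  obtain ⟨U, hU, hdisj⟩ := (S w₀).finite_toSet.t2_separation
  have : ∀ᶠ w in 𝓝 w₀, ∀ z ∈ S w₀, ∃ z' ∈ S w, z' ∈ U z :=
    (Filter.eventually_all_finset _).mpr fun z hz => h z hz _ ((hU z).2.mem_nhds (hU z).1)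
  filter_upwards [this] with w hw
  choose! f hf hfU using hw
  refine Finset.card_le_card_of_injOn f (fun z hz => hf z hz) fun z hz z' hz' hzz' => ?_
  by_contra hne
  exact Set.disjoint_left.mp (hdisj hz hz' hne) (hfU z hz) (hzz' ▸ hfU z' hz')

lemma RootFamily.eventually_card_filter_eq (h : RootFamily p) {N : ℕ}
    (hN : ∀ w, (complexRoots p w).card = N) {q : B → ℝ[X]} (hq : ContPoly q)
    (hqp : ∀ w z, aeval z (q w) = 0 → z ∈ complexRoots p w) (w₀ : B) :
    ∀ᶠ w in 𝓝 w₀, ((realRoots p w).filter fun y => (q w).eval y ≠ 0).card =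
      ((realRoots p w₀).filter fun y => (q w₀).eval y ≠ 0).card := by
  have h1 := eventually_card_le (w₀ := w₀)
    (S := fun w => (realRoots p w).filter fun y => (q w).eval y ≠ 0) (by
      intro y hy U hU
      rw [Finset.mem_filter, h.mem_realRoots] at hy
      obtain ⟨⟨i, hi⟩, hy⟩ := hy
      obtain ⟨V, hV, W, hW, hVW⟩ := Filter.mem_prod_iff.mp
        (nhds_prod_eq (x := w₀) (y := y) ▸ hq.continuous_eval.continuousAt.eventually_ne hy)
      filter_upwards [h.eventually_exists_root (inter_mem hU hW) hi, hV] with w ⟨y', hy', j, hj⟩ hw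
      exact ⟨y', Finset.mem_filter.mpr ⟨h.mem_realRoots.mpr ⟨j, hj⟩, @hVW (w, y') ⟨hw, hy'.2⟩⟩, hy'.1⟩)
  have h2 := eventually_card_le (w₀ := w₀)
    (S := fun w => (complexRoots p w).filter fun z => z.im ≠ 0 ∧ aeval z (q w) ≠ 0) (by
      intro z hz U hU
      rw [Finset.mem_filter, h.mem_complexRoots] at hz
      obtain ⟨⟨i, hi⟩, him, hz⟩ := hz
      obtain ⟨V, hV, W, hW, hVW⟩ := Filter.mem_prod_iff.mp
        (nhds_prod_eq (x := w₀) (y := z) ▸ hq.continuous_aeval.continuousAt.eventually_ne hz)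
      have hIm : {z : ℂ | z.im ≠ 0} ∈ 𝓝 z := Complex.continuous_im.continuousAt.eventually_ne him
      filter_upwards [(h.contPoly i).eventually_exists_aroot hi (inter_mem (inter_mem hU hW) hIm),
        hV] with w ⟨z', hz', hj⟩ hw
      exact ⟨z', Finset.mem_filter.mpr ⟨h.mem_complexRoots.mpr ⟨i, hj⟩, hz'.2,
        @hVW (w, z') ⟨hw, hz'.1.2⟩⟩, hz'.1.1⟩)
  have h3 := eventually_card_le (w₀ := w₀)
    (S := fun w => (complexRoots p w).filter fun z => aeval z (q w) = 0) (by
      intro z hz U hU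
      rw [Finset.mem_filter] at hz
      filter_upwards [hq.eventually_exists_aroot hz.2 hU] with w ⟨z', hz', hj⟩
      exact ⟨z', Finset.mem_filter.mpr ⟨hqp w z' hj, hj⟩, hz'⟩)
  filter_upwards [h1, h2, h3] with w h1 h2 h3
  have e := card_complexRoots_eq p (q w) w fun i => (h.contPoly i).ne w
  have e₀ := card_complexRoots_eq p (q w₀) w₀ fun i => (h.contPoly i).ne w₀
  rw [hN] at e e₀
  omega

lemma RootFamily.eventually_card_eq (h : RootFamily p) {N : ℕ}
    (hN : ∀ w, (complexRoots p w).card = N) (w₀ : B) :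
    ∀ᶠ w in 𝓝 w₀, (realRoots p w).card = (realRoots p w₀).card := by
  simpa using h.eventually_card_filter_eq hN (contPoly_const (one_ne_zero (α := ℝ[X])))
    (fun w z hz => by simp at hz) w₀

lemma RootFamily.continuous_node (h : RootFamily p) {k : ℕ}
    (hk : ∀ w, (realRoots p w).card = k) {i : ℕ} (hi : i < k) :
    Continuous fun w => node (realRoots p w) i := by
  rw [continuous_iff_continuousAt]
  intro w₀
  rw [Metric.continuousAt_iff']
  intro ε hε
  obtain ⟨δ, hδ, hδε, hsep⟩ : ∃ δ > 0, δ ≤ ε ∧ ∀ i j, i < j → j < k →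
      node (realRoots p w₀) i + 2 * δ ≤ node (realRoots p w₀) j := by
    have : ∀ᶠ δ : ℝ in 𝓝[>] 0, δ ≤ ε ∧ ∀ i ∈ Finset.range k, ∀ j ∈ Finset.range k, i < j →
      node (realRoots p w₀) i + 2 * δ ≤ node (realRoots p w₀) j := by
      refine Filter.Eventually.and ?_ ?_
      · filter_upwards [Ioo_mem_nhdsGT hε] with δ hδ using hδ.2.le
      · rw [Filter.eventually_all_finset]
        intro i _
        rw [Filter.eventually_all_finset]
        intro j hj
        by_cases hij : i < j
        · have hlt := node_lt_node hij (by rw [hk w₀]; exact Finset.mem_range.mp hj)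
          filter_upwards [Ioo_mem_nhdsGT
            (show 0 < (node (realRoots p w₀) j - node (realRoots p w₀) i) / 2 by linarith)]
            with δ hδ _
          linarith [hδ.2]
        · exact Filter.Eventually.of_forall fun _ h => absurd h hij
    obtain ⟨δ, ⟨h1, h2⟩, h3⟩ := (this.and self_mem_nhdsWithin).exists
    exact ⟨δ, h3, h1, fun i j hij hj => h2 i (Finset.mem_range.mpr (hij.trans hj)) j
      (Finset.mem_range.mpr hj) hij⟩
  filter_upwards [h.eventually_hClose w₀ hδ] with w hw
  have : ∀ i, ∃ b, i < k → b ∈ realRoots p w ∧ |b - node (realRoots p w₀) i| < δ := by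
    intro i
    by_cases hi : i < k
    · obtain ⟨b, hb⟩ := hw.1 _ (node_mem (i := i) (by rwa [hk w₀]))
      exact ⟨b, fun _ => hb⟩
    · exact ⟨0, fun h => absurd h hi⟩
  choose f hf using this
  rw [node_unique (f := f) (fun i hi => (hf i (by rwa [hk w] at hi)).1) ?_ (by rwa [hk w]),
    Real.dist_eq]
  · exact (hf i hi).2.trans_le hδε
  · intro i j hij hj
    rw [hk w] at hj
    have h1 := abs_lt.mp (hf i (hij.trans hj)).2
    have h2 := abs_lt.mp (hf j hj).2
    linarith [hsep i j hij hj, h1.2, h2.1]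

lemma card_filter_node (Z : Finset ℝ) (P : ℝ → Prop) [DecidablePred P] :
    ((Finset.range Z.card).filter fun i => P (node Z i)).card = (Z.filter P).card := by
  refine Finset.card_bij (fun i _ => node Z i) ?_ ?_ ?_
  · intro i hi
    rw [Finset.mem_filter, Finset.mem_range] at hi
    exact Finset.mem_filter.mpr ⟨node_mem hi.1, hi.2⟩
  · intro i hi j hj hij
    rw [Finset.mem_filter, Finset.mem_range] at hi hj
    rcases lt_trichotomy i j with h | h | h
    · exact absurd hij (node_lt_node h hj.1).ne
    · exact h
    · exact absurd hij (node_lt_node h hi.1).ne'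
  · intro z hz
    rw [Finset.mem_filter] at hz
    obtain ⟨i, hi, rfl⟩ := exists_node_eq hz.1
    exact ⟨i, Finset.mem_filter.mpr ⟨Finset.mem_range.mpr hi, hz.2⟩, rfl⟩

lemma RootFamily.eventually_node_iff (h : RootFamily p) {N : ℕ}
    (hN : ∀ w, (complexRoots p w).card = N) {k : ℕ} (hk : ∀ w, (realRoots p w).card = k)
    (j : ι) {i : ℕ} (hi : i < k) (w₀ : B) :
    ∀ᶠ w in 𝓝 w₀, (p j w).eval (node (realRoots p w) i) = 0 ↔
      (p j w₀).eval (node (realRoots p w₀) i) = 0 := by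
  set S : B → Finset ℕ := fun w =>
    (Finset.range k).filter fun i => (p j w).eval (node (realRoots p w) i) ≠ 0 with hS
  have hcard : ∀ w, (S w).card = ((realRoots p w).filter fun y => (p j w).eval y ≠ 0).card := by
    intro w
    have := card_filter_node (realRoots p w) fun y => (p j w).eval y ≠ 0
    rwa [hk w] at this
  have hsub : ∀ᶠ w in 𝓝 w₀, ∀ i ∈ S w₀, i ∈ S w := by
    rw [Filter.eventually_all_finset]
    intro i hi
    rw [hS, Finset.mem_filter, Finset.mem_range] at hi
    have hc : Continuous fun w => (p j w).eval (node (realRoots p w) i) :=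
      (h.contPoly j).continuous_eval.comp (continuous_id.prodMk (h.continuous_node hk hi.1))
    filter_upwards [hc.continuousAt.eventually_ne hi.2] with w hw
    exact Finset.mem_filter.mpr ⟨Finset.mem_range.mpr hi.1, hw⟩
  filter_upwards [hsub, h.eventually_card_filter_eq hN (h.contPoly j)
    (fun w z hz => h.mem_complexRoots.mpr ⟨j, hz⟩) w₀] with w hw hw'
  have heq : S w₀ = S w := Finset.eq_of_subset_of_card_le hw (by rw [hcard, hcard, hw'])
  have := Finset.ext_iff.mp heq i
  simp only [hS, Finset.mem_filter, Finset.mem_range, hi, true_and] at this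
  exact not_iff_not.mp this.symm

variable [PreconnectedSpace B]

lemma RootFamily.card_eq (h : RootFamily p) {N : ℕ} (hN : ∀ w, (complexRoots p w).card = N)
    (w w' : B) : (realRoots p w).card = (realRoots p w').card :=
  IsLocallyConstant.apply_eq_of_preconnectedSpace
    ((IsLocallyConstant.iff_eventually_eq _).mpr fun w => h.eventually_card_eq hN w) w w'

lemma RootFamily.node_iff (h : RootFamily p) {N : ℕ}
    (hN : ∀ w, (complexRoots p w).card = N) {k : ℕ} (hk : ∀ w, (realRoots p w).card = k)
    (j : ι) {i : ℕ} (hi : i < k) (w w' : B) :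
    (p j w).eval (node (realRoots p w) i) = 0 ↔ (p j w').eval (node (realRoots p w') i) = 0 := by
  have := IsLocallyConstant.apply_eq_of_preconnectedSpace
    (f := fun w => (p j w).eval (node (realRoots p w) i) = 0)
    ((IsLocallyConstant.iff_eventually_eq _).mpr fun w => by
      filter_upwards [h.eventually_node_iff hN hk j hi w] with w' hw'
      exact propext hw') w w'
  exact iff_of_eq this

/-- Along a connected parameter space with a constant number of complex roots, the sign of each
member of the family at a point with a fixed label is constant. -/
lemma RootFamily.sign_nodeIso (h : RootFamily p) {N : ℕ}
    (hN : ∀ w, (complexRoots p w).card = N) (j : ι) (τ : ℝ) (hne : ∀ w, (realRoots p w).Nonempty)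
    (w w' : B) : SignType.sign ((p j w).eval (nodeIso (realRoots p w) τ)) =
      SignType.sign ((p j w').eval (nodeIso (realRoots p w') τ)) := by
  have hk : ∀ v, (realRoots p v).card = (realRoots p w).card := fun v => h.card_eq hN v w
  set k := (realRoots p w).card with hkdef
  have hk0 : 0 < k := (hne w).card_pos
  have hcont : Continuous fun v => (p j v).eval (nodeIso (realRoots p v) τ) := by
    refine (h.contPoly j).continuous_eval.comp (continuous_id.prodMk ?_)
    simp only [nodeIso_apply, hk]
    exact continuous_interp_comp (fun i hi => h.continuous_node hk (by omega)) continuous_const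
  have hzero : ∀ v v', (p j v).eval (nodeIso (realRoots p v) τ) = 0 →
      (p j v').eval (nodeIso (realRoots p v') τ) = 0 := by
    intro v v' hv
    obtain ⟨i, hi, hiτ⟩ := exists_node_eq (h.mem_realRoots.mpr ⟨j, hv⟩)
    rw [← nodeIso_natCast hi] at hiτ
    have hτ := (nodeIso (realRoots p v)).injective hiτ
    rw [hk v] at hi
    rw [← hτ, nodeIso_natCast (by rwa [hk])] at hv ⊢
    exact (h.node_iff hN hk j hi v v').mp hv
  have hloc : IsLocallyConstant fun v =>
      SignType.sign ((p j v).eval (nodeIso (realRoots p v) τ)) := by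
    rw [IsLocallyConstant.iff_eventually_eq]
    intro v
    rcases lt_trichotomy ((p j v).eval (nodeIso (realRoots p v) τ)) 0 with hs | hs | hs
    · filter_upwards [hcont.continuousAt.eventually_lt continuousAt_const hs] with v' hv'
      rw [sign_neg hs, sign_neg hv']
    · exact Filter.Eventually.of_forall fun v' => by rw [hs, hzero v v' hs]
    · filter_upwards [continuousAt_const.eventually_lt hcont.continuousAt hs] with v' hv'
      rw [sign_pos hs, sign_pos hv']
  exact hloc.apply_eq_of_preconnectedSpace w w'

end Local

end ConicStructure

namespace ConicStructure

open Polynomial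

/-- A (time-dependent) flow on `E`: `G s t` transports the fibre at time `s` to that at `t`. -/
structure IsFlow {E : Type*} [TopologicalSpace E] (G : ℝ → ℝ → E → E) : Prop where
  cont : Continuous fun z : ℝ × ℝ × E => G z.1 z.2.1 z.2.2
  self : ∀ s x, G s s x = x
  comp : ∀ s t u x, G t u (G s t x) = G s u x

section Lift

variable {E ι : Type*} [Fintype ι]

/-- The lift of the flow `G` to `ℝ × E` along the real roots of the family `p`. -/
def liftFlow (G : ℝ → ℝ → E → E) (p : ι → ℝ × E → ℝ[X]) (s t : ℝ) (z : ℝ × E) : ℝ × E :=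
  (nodeIso (realRoots p (t, G s t z.2)) ((nodeIso (realRoots p (s, z.2))).symm z.1), G s t z.2)

lemma pos_of_pos_of_ne_zero {f : ℝ → ℝ} (hf : Continuous f) {I : Set ℝ} (hI : IsPreconnected I)
    (h : ∀ u ∈ I, f u ≠ 0) {s t : ℝ} (hs : s ∈ I) (ht : t ∈ I) (hpos : 0 < f s) : 0 < f t := by
  by_contra hneg
  obtain ⟨u, hu, hu0⟩ := hI.intermediate_value ht hs hf.continuousOn ⟨not_lt.mp hneg, hpos.le⟩
  exact h u hu hu0

lemma eventually_ne_natCast (k : ℕ) (τ₀ : ℝ) : ∀ᶠ τ in 𝓝 τ₀, τ ≠ τ₀ → ∀ i < k, τ ≠ (i : ℝ) := by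
  have : ∀ᶠ τ in 𝓝 τ₀, ∀ i ∈ Finset.range k, τ ≠ τ₀ → τ ≠ (i : ℝ) := by
    rw [Filter.eventually_all_finset]
    intro i _
    by_cases hi : τ₀ = i
    · exact Filter.Eventually.of_forall fun τ hτ => hi ▸ hτ
    · filter_upwards [eventually_ne_nhds hi] with τ hτ _ using hτ
  filter_upwards [this] with τ hτ h i hi using hτ i (Finset.mem_range.mpr hi) h

lemma exists_gap (A : Finset ℝ) {y : ℝ} (hy : y ∉ A) : ∀ᶠ η in 𝓝[>] (0 : ℝ),
    ∀ a ∈ A, 3 * η ≤ |a - y| := by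
  rw [Filter.eventually_all_finset]
  intro a ha
  have : 0 < |a - y| := abs_pos.mpr (sub_ne_zero.mpr fun h => hy (h ▸ ha))
  filter_upwards [Ioo_mem_nhdsGT (show 0 < |a - y| / 3 by linarith)] with η hη
  linarith [hη.2]

lemma nodeIso_notMem {Z : Finset ℝ} {τ : ℝ} (hτ : ∀ i < Z.card, τ ≠ (i : ℝ)) :
    nodeIso Z τ ∉ Z := by
  intro h
  obtain ⟨i, hi, hiτ⟩ := exists_node_eq h
  rw [← nodeIso_natCast hi] at hiτ
  exact hτ i hi ((nodeIso Z).injective hiτ).symm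

lemma exists_isCut {Z : Finset ℝ} {y : ℝ} (hy : y ∉ Z) : ∃ c, IsCut Z y c := by
  have hτ : ∀ i < Z.card, (nodeIso Z).symm y ≠ (i : ℝ) := by
    intro i hi h
    apply hy
    rw [← (nodeIso Z).apply_symm_apply y, h, nodeIso_natCast hi]
    exact node_mem hi
  obtain ⟨c, hc, h1, h2⟩ := exists_label_cut Z.card hτ
  refine ⟨c, ?_⟩
  have := isCut_nodeIso hc h1 h2
  rwa [(nodeIso Z).apply_symm_apply] at this

variable [TopologicalSpace E] {G : ℝ → ℝ → E → E} {p : ι → ℝ × E → ℝ[X]}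

lemma IsFlow.continuous_leaf (hG : IsFlow G) (s : ℝ) (x : E) : Continuous fun u => (u, G s u x) :=
  continuous_id.prodMk (hG.cont.comp (by fun_prop : Continuous fun u : ℝ => (s, u, x)))

lemma continuous_nodeIso_leaf (hG : IsFlow G) (hp : RootFamily p) {s : ℝ} {x : E} {N : ℕ}
    (hN : ∀ u, (complexRoots p (u, G s u x)).card = N)
    (hne : ∀ w, (realRoots p w).Nonempty) (τ : ℝ) :
    Continuous fun u => nodeIso (realRoots p (u, G s u x)) τ := by
  have hp' := hp.comp (hG.continuous_leaf s x)
  have hk : ∀ u, (realRoots p (u, G s u x)).card = (realRoots p (s, G s s x)).card :=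
    fun u => hp'.card_eq hN u s
  have hpos := (hne (s, G s s x)).card_pos
  simp only [nodeIso_apply, hk]
  exact continuous_interp_comp (fun i hi => hp'.continuous_node hk (by omega)) continuous_const

lemma isCut_leaf (hG : IsFlow G) (hp : RootFamily p) {s : ℝ} {x : E} {N : ℕ}
    (hN : ∀ u, (complexRoots p (u, G s u x)).card = N) {y : ℝ → ℝ}
    (hy : Continuous y) {I : Set ℝ} (hI : IsPreconnected I)
    (hyI : ∀ u ∈ I, y u ∉ realRoots p (u, G s u x)) {t t' : ℝ} (ht : t ∈ I) (ht' : t' ∈ I) {c : ℕ}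
    (hc : IsCut (realRoots p (t, G s t x)) (y t) c) :
    IsCut (realRoots p (t', G s t' x)) (y t') c := by
  have hp' := hp.comp (hG.continuous_leaf s x)
  have hk : ∀ u, (realRoots p (u, G s u x)).card = (realRoots p (t, G s t x)).card :=
    fun u => hp'.card_eq hN u t
  obtain ⟨h0, h1, h2⟩ := hc
  have hnode : ∀ i < (realRoots p (t, G s t x)).card, ∀ u ∈ I,
      node (realRoots p (u, G s u x)) i ≠ y u := fun i hi u hu h =>
    hyI u hu (h ▸ node_mem (by rwa [hk u]))
  refine ⟨by rwa [hk t'], fun i hi => ?_, fun i hi hi' => ?_⟩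
  · have hi' := hi.trans_le h0
    have := pos_of_pos_of_ne_zero (f := fun u => y u - node (realRoots p (u, G s u x)) i)
      (hy.sub (hp'.continuous_node hk hi')) hI
      (fun u hu => sub_ne_zero.mpr (hnode i hi' u hu).symm) ht ht' (sub_pos.mpr (h1 i hi))
    exact sub_pos.mp this
  · rw [hk t'] at hi'
    have := pos_of_pos_of_ne_zero (f := fun u => node (realRoots p (u, G s u x)) i - y u)
      ((hp'.continuous_node hk hi').sub hy) hI
      (fun u hu => sub_ne_zero.mpr (hnode i hi' u hu)) ht ht' (sub_pos.mpr (h2 i hi hi'))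
    exact sub_pos.mp this

lemma eventually_exists_label (hG : IsFlow G) (hp : RootFamily p)
    (hN : ∀ s x, ∃ N, ∀ u, (complexRoots p (u, G s u x)).card = N)
    (hne : ∀ w, (realRoots p w).Nonempty) (s₀ t₀ : ℝ) (x₀ : E) {τ : ℝ}
    (hτ : ∀ i < (realRoots p (s₀, x₀)).card, τ ≠ (i : ℝ)) {ε : ℝ} (hε : 0 < ε) :
    ∀ᶠ z : ℝ × ℝ × E in 𝓝 (s₀, t₀, x₀), ∃ τ',
      |nodeIso (realRoots p (z.1, z.2.2)) τ' - nodeIso (realRoots p (s₀, x₀)) τ| < ε ∧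
      |nodeIso (realRoots p (z.2.1, G z.1 z.2.1 z.2.2)) τ' -
        nodeIso (realRoots p (t₀, G s₀ t₀ x₀)) τ| < ε := by
  obtain ⟨N, hN₀⟩ := hN s₀ x₀
  set y : ℝ → ℝ := fun u => nodeIso (realRoots p (u, G s₀ u x₀)) τ with hy
  have hyc : Continuous y := continuous_nodeIso_leaf hG hp hN₀ hne τ
  have hk : ∀ u, (realRoots p (u, G s₀ u x₀)).card = (realRoots p (s₀, x₀)).card := fun u => by
    have : (realRoots p (u, G s₀ u x₀)).card = (realRoots p (s₀, G s₀ s₀ x₀)).card :=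
      (hp.comp (hG.continuous_leaf s₀ x₀)).card_eq hN₀ u s₀
    rwa [hG.self s₀ x₀] at this
  have hynot : ∀ u, y u ∉ realRoots p (u, G s₀ u x₀) := fun u => nodeIso_notMem (by rwa [hk u])
  obtain ⟨c, hck, hc1, hc2⟩ := exists_label_cut _ hτ
  have hcut : ∀ u, IsCut (realRoots p (u, G s₀ u x₀)) (y u) c := fun u =>
    isCut_nodeIso (by rwa [hk u]) hc1 (by rwa [hk u])
  obtain ⟨η, ⟨⟨hηs, hηt⟩, hηε⟩, hη⟩ := ((((exists_gap _ (hynot s₀)).and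
    (exists_gap _ (hynot t₀))).and (Ioo_mem_nhdsGT hε)).and self_mem_nhdsWithin).exists
  replace hη : 0 < η := hη
  set I : Set ℝ := Icc (min s₀ t₀ - 1) (max s₀ t₀ + 1) with hI
  have hIs : I ∈ 𝓝 s₀ := Icc_mem_nhds (by linarith [min_le_left s₀ t₀])
    (by linarith [le_max_left s₀ t₀])
  have hIt : I ∈ 𝓝 t₀ := Icc_mem_nhds (by linarith [min_le_right s₀ t₀])
    (by linarith [le_max_right s₀ t₀])
  have htube : ∀ᶠ z : ℝ × E in 𝓝 (s₀, x₀), ∀ u ∈ I, ∀ i, (p i (u, G z.1 u z.2)).eval (y u) ≠ 0 := by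
    refine isCompact_Icc.eventually_forall_of_forall_eventually fun u _ => ?_
    rw [Filter.eventually_all]
    intro i
    have hcont : Continuous fun q : (ℝ × E) × ℝ => (p i (q.2, G q.1.1 q.2 q.1.2)).eval (y q.2) := by
      refine (hp.contPoly i).continuous_eval.comp (f := fun q : (ℝ × E) × ℝ =>
        ((q.2, G q.1.1 q.2 q.1.2), y q.2)) ((continuous_snd.prodMk ?_).prodMk
          (hyc.comp continuous_snd))
      exact hG.cont.comp (by fun_prop : Continuous fun q : (ℝ × E) × ℝ => (q.1.1, q.2, q.1.2))
    refine hcont.continuousAt.eventually_ne (x := ((s₀, x₀), u)) fun h => hynot u ?_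
    exact hp.mem_realRoots.mpr ⟨i, h⟩
  have hsx : Tendsto (fun z : ℝ × ℝ × E => (z.1, z.2.2)) (𝓝 (s₀, t₀, x₀)) (𝓝 (s₀, x₀)) :=
    (by fun_prop : Continuous fun z : ℝ × ℝ × E => (z.1, z.2.2)).tendsto _
  have htx : Tendsto (fun z : ℝ × ℝ × E => (z.2.1, G z.1 z.2.1 z.2.2)) (𝓝 (s₀, t₀, x₀))
      (𝓝 (t₀, G s₀ t₀ x₀)) :=
    ((continuous_fst.comp continuous_snd).prodMk hG.cont).tendsto _
  have hs : Tendsto (fun z : ℝ × ℝ × E => z.1) (𝓝 (s₀, t₀, x₀)) (𝓝 s₀) :=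
    continuous_fst.tendsto _
  have ht : Tendsto (fun z : ℝ × ℝ × E => z.2.1) (𝓝 (s₀, t₀, x₀)) (𝓝 t₀) :=
    (continuous_fst.comp continuous_snd).tendsto _
  have hnear : ∀ u, ∀ᶠ v in 𝓝 u, |y v - y u| < η := fun u => by
    have := Metric.continuousAt_iff'.mp (hyc.continuousAt (x := u)) η hη
    simpa only [Real.dist_eq] using this
  filter_upwards [hsx.eventually htube, hsx.eventually (hp.eventually_hClose _ hη),
    htx.eventually (hp.eventually_hClose _ hη), hs.eventually hIs, ht.eventually hIt,
    hs.eventually (hnear s₀), ht.eventually (hnear t₀)] with ⟨s, t, x⟩ h1 h2 h3 h4 h5 h6 h7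
  dsimp only at h1 h2 h3 h4 h5 h6 h7 ⊢
  obtain ⟨N', hN'⟩ := hN s x
  have hnot : ∀ u ∈ I, y u ∉ realRoots p (u, G s u x) := fun u hu hmem => by
    obtain ⟨i, hi⟩ := hp.mem_realRoots.mp hmem
    exact h1 u hu i hi
  obtain ⟨c', hc'⟩ := exists_isCut (hnot s h4)
  have hc't := isCut_leaf hG hp hN' hyc isPreconnected_Icc hnot h4 h5 hc'
  have hs₀ := hcut s₀
  have hηs' := hηs
  rw [hG.self] at hc' hs₀ hηs'
  have g1 := (gapClose_of_hClose h2 hs₀ hc' hηs' h6).abs_nodeIso_sub_lt (hne _) hck hc1 hc2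
  have g2 := (gapClose_of_hClose h3 (hcut t₀) hc't hηt h7).abs_nodeIso_sub_lt (hne _)
    (by rwa [hk t₀]) hc1 (by rwa [hk t₀])
  exact ⟨τ + (c' - c), g1.trans hηε.2, g2.trans hηε.2⟩

lemma continuous_liftFlow (hG : IsFlow G) (hp : RootFamily p)
    (hN : ∀ s x, ∃ N, ∀ u, (complexRoots p (u, G s u x)).card = N)
    (hne : ∀ w, (realRoots p w).Nonempty) :
    Continuous fun z : ℝ × ℝ × (ℝ × E) => liftFlow G p z.1 z.2.1 z.2.2 := by
  refine Continuous.prodMk ?_ (hG.cont.comp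
    (by fun_prop : Continuous fun z : ℝ × ℝ × (ℝ × E) => (z.1, z.2.1, z.2.2.2)))
  rw [continuous_iff_continuousAt]
  rintro ⟨s₀, t₀, y₀, x₀⟩
  rw [Metric.continuousAt_iff']
  intro ε hε
  simp only [Real.dist_eq]
  set A₀ := realRoots p (s₀, x₀) with hA₀
  set A₁ := realRoots p (t₀, G s₀ t₀ x₀) with hA₁
  set τ₀ := (nodeIso A₀).symm y₀ with hτ₀
  have hy₀ : nodeIso A₀ τ₀ = y₀ := (nodeIso A₀).apply_symm_apply y₀
  have hclose : ∀ᶠ τ in 𝓝 τ₀, |nodeIso A₁ τ - nodeIso A₁ τ₀| < ε / 2 := by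
    have := Metric.continuousAt_iff'.mp ((nodeIso A₁).continuous.continuousAt (x := τ₀)) (ε / 2)
      (by linarith)
    simpa only [Real.dist_eq] using this
  have hgood := hclose.and (eventually_ne_natCast A₀.card τ₀)
  obtain ⟨a, ⟨ha1, ha2⟩, ha⟩ := ((hgood.filter_mono nhdsWithin_le_nhds).and
    (self_mem_nhdsWithin (a := τ₀) (s := Iio τ₀))).exists
  obtain ⟨b, ⟨hb1, hb2⟩, hb⟩ := ((hgood.filter_mono nhdsWithin_le_nhds).and
    (self_mem_nhdsWithin (a := τ₀) (s := Ioi τ₀))).exists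
  replace ha : a < τ₀ := ha
  replace hb : τ₀ < b := hb
  have hya : nodeIso A₀ a < y₀ := by rw [← hy₀]; exact (nodeIso A₀).strictMono ha
  have hyb : y₀ < nodeIso A₀ b := by rw [← hy₀]; exact (nodeIso A₀).strictMono hb
  set δ := min (ε / 2) (min ((y₀ - nodeIso A₀ a) / 2) ((nodeIso A₀ b - y₀) / 2)) with hδdef
  have hδ : 0 < δ := lt_min (by linarith) (lt_min (by linarith) (by linarith))
  have hδ1 : δ ≤ ε / 2 := min_le_left _ _
  have hδ2 : δ ≤ (y₀ - nodeIso A₀ a) / 2 := (min_le_right _ _).trans (min_le_left _ _)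
  have hδ3 : δ ≤ (nodeIso A₀ b - y₀) / 2 := (min_le_right _ _).trans (min_le_right _ _)
  have hproj : Tendsto (fun z : ℝ × ℝ × (ℝ × E) => (z.1, z.2.1, z.2.2.2)) (𝓝 (s₀, t₀, y₀, x₀))
      (𝓝 (s₀, t₀, x₀)) :=
    (by fun_prop : Continuous fun z : ℝ × ℝ × (ℝ × E) => (z.1, z.2.1, z.2.2.2)).tendsto _
  have hyev : ∀ᶠ z : ℝ × ℝ × (ℝ × E) in 𝓝 (s₀, t₀, y₀, x₀), |z.2.2.1 - y₀| < δ := by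
    have : Continuous fun z : ℝ × ℝ × (ℝ × E) => |z.2.2.1 - y₀| := by fun_prop
    exact this.continuousAt.eventually_lt continuousAt_const (by simpa using hδ)
  filter_upwards [hproj.eventually (eventually_exists_label hG hp hN hne s₀ t₀ x₀ (ha2 ha.ne) hδ),
    hproj.eventually (eventually_exists_label hG hp hN hne s₀ t₀ x₀ (hb2 hb.ne') hδ), hyev]
    with ⟨s, t, y, x⟩ ⟨a', ha', ha''⟩ ⟨b', hb', hb''⟩ hy
  dsimp only at ha' ha'' hb' hb'' hy ⊢
  rw [abs_lt] at ha' ha'' hb' hb'' hy ha1 hb1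
  set τ := (nodeIso (realRoots p (s, x))).symm y with hτ
  have hτy : nodeIso (realRoots p (s, x)) τ = y := OrderIso.apply_symm_apply _ _
  have h1 : a' < τ := (nodeIso (realRoots p (s, x))).lt_iff_lt.mp (by rw [hτy]; linarith)
  have h2 : τ < b' := (nodeIso (realRoots p (s, x))).lt_iff_lt.mp (by rw [hτy]; linarith)
  have h3 := (nodeIso (realRoots p (t, G s t x))).strictMono h1
  have h4 := (nodeIso (realRoots p (t, G s t x))).strictMono h2
  rw [abs_lt]
  constructor <;> linarith

lemma isFlow_liftFlow (hG : IsFlow G) (hp : RootFamily p)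
    (hN : ∀ s x, ∃ N, ∀ u, (complexRoots p (u, G s u x)).card = N)
    (hne : ∀ w, (realRoots p w).Nonempty) : IsFlow (liftFlow G p) where
  cont := continuous_liftFlow hG hp hN hne
  self s z := by simp [liftFlow, hG.self]
  comp s t u z := by simp [liftFlow, hG.comp]

lemma sign_liftFlow (hG : IsFlow G) (hp : RootFamily p)
    (hN : ∀ s x, ∃ N, ∀ u, (complexRoots p (u, G s u x)).card = N)
    (hne : ∀ w, (realRoots p w).Nonempty) (i : ι) (s t : ℝ) (z : ℝ × E) :
    SignType.sign ((p i (t, (liftFlow G p s t z).2)).eval (liftFlow G p s t z).1) =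
      SignType.sign ((p i (s, z.2)).eval z.1) := by
  obtain ⟨N, hN⟩ := hN s z.2
  have := (hp.comp (hG.continuous_leaf s z.2)).sign_nodeIso hN i
    ((nodeIso (realRoots p (s, z.2))).symm z.1) (fun _ => hne _) t s
  have e : ∀ w, realRoots (fun i u => p i (u, G s u z.2)) w = realRoots p (w, G s w z.2) :=
    fun _ => rfl
  simp only [e, hG.self, OrderIso.apply_symm_apply] at this
  exact this

end Lift

end ConicStructure

namespace ConicStructure

section DistinctRoots

/-- The product of the differences of all ordered pairs of distinct elements of `I`. -/
def diffProd {R ι : Type*} [CommRing R] [DecidableEq ι] (w : ι → R) (I : Finset ι) : R :=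
  ∏ i ∈ I, ∏ j ∈ I.erase i, (w i - w j)

/-- The sum of `diffProd` over all subsets of cardinality `k`. -/
def subdisc {R : Type*} [CommRing R] {d : ℕ} (w : Fin d → R) (k : ℕ) : R :=
  ∑ I ∈ Finset.powersetCard k Finset.univ, diffProd w I

lemma diffProd_eq_of_injOn {R ι : Type*} [CommRing R] [DecidableEq ι] [DecidableEq R] {w : ι → R}
    {I : Finset ι} (h : Set.InjOn w I) : diffProd w I = diffProd id (I.image w) := by
  unfold diffProd
  rw [Finset.prod_image h]
  refine Finset.prod_congr rfl fun i hi => ?_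
  have : (I.image w).erase (w i) = (I.erase i).image w := by
    ext x
    simp only [Finset.mem_erase, Finset.mem_image]
    constructor
    · rintro ⟨hx, j, hj, rfl⟩
      exact ⟨j, ⟨fun hji => hx (hji ▸ rfl), hj⟩, rfl⟩
    · rintro ⟨j, ⟨hji, hj⟩, rfl⟩
      exact ⟨fun hw => hji (h hj hi hw), j, hj, rfl⟩
  rw [this, Finset.prod_image (h.mono (by simp))]
  rfl

lemma diffProd_eq_zero {R ι : Type*} [CommRing R] [DecidableEq ι] {w : ι → R} {I : Finset ι}
    (h : ¬ Set.InjOn w I) : diffProd w I = 0 := by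
  simp only [Set.InjOn, not_forall] at h
  obtain ⟨i, hi, j, hj, hij, hne⟩ := h
  refine Finset.prod_eq_zero hi (Finset.prod_eq_zero (i := j) ?_ (by rw [hij, sub_self]))
  exact Finset.mem_erase.mpr ⟨Ne.symm hne, hj⟩

lemma diffProd_id_ne_zero {R : Type*} [CommRing R] [IsDomain R] [DecidableEq R] (I : Finset R) :
    diffProd id I ≠ 0 :=
  Finset.prod_ne_zero_iff.mpr fun _ _ => Finset.prod_ne_zero_iff.mpr fun _ hj =>
    sub_ne_zero.mpr (Finset.ne_of_mem_erase hj).symm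

lemma subdisc_ne_zero {R : Type*} [CommRing R] [IsDomain R] [CharZero R] [DecidableEq R] {d : ℕ}
    (w : Fin d → R) : subdisc w (Finset.univ.image w).card ≠ 0 := by
  classical
  set S := Finset.univ.image w with hS
  have h1 : subdisc w S.card = ∑ I ∈ (Finset.powersetCard S.card Finset.univ).filter
      (fun I : Finset (Fin d) => Set.InjOn w I), diffProd id S := by
    rw [subdisc, Finset.sum_filter]
    refine Finset.sum_congr rfl fun I hI => ?_
    split_ifs with h
    · rw [diffProd_eq_of_injOn h]
      congr 1
      refine Finset.eq_of_subset_of_card_le (Finset.image_subset_image (Finset.subset_univ _)) ?_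
      rw [Finset.card_image_of_injOn h, (Finset.mem_powersetCard.mp hI).2]
    · exact diffProd_eq_zero h
  rw [h1, Finset.sum_const, nsmul_eq_mul]
  refine mul_ne_zero (Nat.cast_ne_zero.mpr (Finset.card_pos.mpr ?_).ne') (diffProd_id_ne_zero _)
  obtain ⟨u, -, hu, himg⟩ := Finset.exists_subset_injOn_image_eq_of_surjOn (f := w)
    (Finset.univ : Finset (Fin d)) S (by
      intro x hx
      rw [hS] at hx
      simpa using hx)
  refine ⟨u, ?_⟩
  rw [Finset.mem_filter, Finset.mem_powersetCard]
  exact ⟨⟨Finset.subset_univ _, by rw [← himg, Finset.card_image_of_injOn hu]⟩, hu⟩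

lemma subdisc_eq_zero {R : Type*} [CommRing R] [DecidableEq R] {d k : ℕ} (w : Fin d → R)
    (hk : (Finset.univ.image w).card < k) : subdisc w k = 0 := by
  refine Finset.sum_eq_zero fun I hI => diffProd_eq_zero fun h => ?_
  have h1 := Finset.card_image_of_injOn h
  rw [(Finset.mem_powersetCard.mp hI).2] at h1
  have := Finset.card_le_card (Finset.image_subset_image (f := w) (Finset.subset_univ I))
  omega

lemma map_subdisc {R S : Type*} [CommRing R] [CommRing S] (f : R →+* S) {d : ℕ} (w : Fin d → R)
    (k : ℕ) : f (subdisc w k) = subdisc (fun i => f (w i)) k := by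
  simp [subdisc, diffProd, map_sum, map_prod]

lemma isSymmetric_subdisc (d k : ℕ) :
    (subdisc (fun i : Fin d => (MvPolynomial.X i : MvPolynomial (Fin d) ℤ)) k).IsSymmetric := by
  intro e
  have : MvPolynomial.rename e (subdisc (fun i : Fin d =>
      (MvPolynomial.X i : MvPolynomial (Fin d) ℤ)) k) =
      subdisc (fun i => MvPolynomial.X (e i)) k := by
    have := map_subdisc (MvPolynomial.rename (R := ℤ) e).toRingHom
      (fun i : Fin d => (MvPolynomial.X i : MvPolynomial (Fin d) ℤ)) k
    simpa using this
  rw [this]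
  refine Finset.sum_bij' (fun I _ => I.map e.toEmbedding) (fun I _ => I.map e.symm.toEmbedding)
    ?_ ?_ ?_ ?_ ?_
  · intro I hI
    simpa [Finset.mem_powersetCard] using hI
  · intro I hI
    simpa [Finset.mem_powersetCard] using hI
  · intro I _
    ext; simp
  · intro I _
    ext; simp
  · intro I _
    unfold diffProd
    rw [Finset.prod_map]
    refine Finset.prod_congr rfl fun i _ => ?_
    rw [Equiv.coe_toEmbedding, ← Equiv.coe_toEmbedding e, ← Finset.map_erase, Finset.prod_map]

lemma map_aeval_int {R S σ : Type*} [CommRing R] [CommRing S] (f : R →+* S) (v : σ → R)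
    (r : MvPolynomial σ ℤ) :
    f (MvPolynomial.aeval v r) = MvPolynomial.aeval (fun i => f (v i)) r := by
  rw [MvPolynomial.map_aeval, MvPolynomial.coe_eval₂Hom, MvPolynomial.aeval_def]
  congr 1
  exact RingHom.ext_int _ _

lemma exists_fin_map_eq {α : Type*} {m : Multiset α} {d : ℕ} (h : Multiset.card m = d) :
    ∃ z : Fin d → α, Finset.univ.val.map z = m := by
  subst h
  induction m using Quotient.inductionOn with
  | _ l => exact ⟨fun i => l.get i, by
      change Multiset.map (fun i : Fin l.length => l.get i) Finset.univ.val = (l : Multiset α)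
      rw [Fin.univ_val_map]
      exact congrArg _ (List.ofFn_get l)⟩

/-- The number of distinct complex roots is determined by the vanishing of finitely many
polynomial expressions in the coefficients. -/
theorem exists_distinct_roots_detector {A : Type*} [CommRing A] (P : Polynomial A) :
    ∃ D : ℕ → A, ∀ e : A →+* ℝ, e P.leadingCoeff ≠ 0 →
      e (D ((P.map e).aroots ℂ).toFinset.card) ≠ 0 ∧
      ∀ k, e (D k) ≠ 0 → k ≤ ((P.map e).aroots ℂ).toFinset.card := by
  classical
  set d := P.natDegree with hd
  set c := P.leadingCoeff with hc
  have hq : ∀ k, ∃ q : MvPolynomial (Fin d) ℤ,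
      MvPolynomial.aeval (fun i : Fin d => MvPolynomial.esymm (Fin d) ℤ (i + 1)) q =
        subdisc (fun i : Fin d => (MvPolynomial.X i : MvPolynomial (Fin d) ℤ)) k := by
    intro k
    obtain ⟨q, hq⟩ := MvPolynomial.esymmAlgHom_surjective (σ := Fin d) (n := d) ℤ (by simp)
      ⟨_, isSymmetric_subdisc d k⟩
    refine ⟨q, ?_⟩
    rw [← MvPolynomial.esymmAlgHom_apply, hq]
  choose q hq using hq
  refine ⟨fun k => MvPolynomial.aeval
    (fun i : Fin d => (-1) ^ ((i : ℕ) + 1) * c ^ (i : ℕ) * P.coeff (d - (i + 1))) (q k), ?_⟩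
  intro e he
  set f : A →+* ℂ := (algebraMap ℝ ℂ).comp e with hf
  have hfc : f c ≠ 0 := by
    simpa [hf] using he
  have hmap : (P.map e).aroots ℂ = (P.map f).roots := by
    rw [Polynomial.aroots_def, Polynomial.map_map]
  have hdeg : (P.map f).natDegree = d := Polynomial.natDegree_map_of_leadingCoeff_ne_zero f hfc
  have hcard : Multiset.card (P.map f).roots = d := by
    rw [← hdeg]
    exact ((IsAlgClosed.splits (P.map f)).natDegree_eq_card_roots).symm
  obtain ⟨z, hz⟩ := exists_fin_map_eq hcard
  set w : Fin d → ℂ := fun i => f c * z i with hw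
  have key : ∀ k, f (MvPolynomial.aeval
      (fun i : Fin d => (-1) ^ ((i : ℕ) + 1) * c ^ (i : ℕ) * P.coeff (d - (i + 1))) (q k)) =
      subdisc w k := by
    intro k
    have h1 : subdisc w k = MvPolynomial.aeval w
        (subdisc (fun i : Fin d => (MvPolynomial.X i : MvPolynomial (Fin d) ℤ)) k) := by
      have := map_subdisc (MvPolynomial.aeval (R := ℤ) w).toRingHom
        (fun i : Fin d => (MvPolynomial.X i : MvPolynomial (Fin d) ℤ)) k
      simpa using this.symm
    rw [h1, ← hq k]
    rw [map_aeval_int]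
    have h3 : ∀ i : Fin d, f ((-1) ^ ((i : ℕ) + 1) * c ^ (i : ℕ) * P.coeff (d - (i + 1))) =
        MvPolynomial.aeval w (MvPolynomial.esymm (Fin d) ℤ (i + 1)) := by
      intro i
      rw [MvPolynomial.aeval_esymm_eq_multiset_esymm]
      have hw' : Finset.univ.val.map w = ((P.map f).roots).map (f c • ·) := by
        rw [← hz, Multiset.map_map]
        rfl
      rw [hw', ← Multiset.pow_smul_esymm]
      have h4 := Polynomial.coeff_eq_esymm_roots_of_card (p := P.map f) (by rw [hcard, hdeg])
        (k := d - (i + 1)) (by rw [hdeg]; exact Nat.sub_le _ _)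
      rw [hdeg, Nat.sub_sub_self i.2, Nat.succ_eq_add_one, Polynomial.coeff_map,
        Polynomial.leadingCoeff_map_of_leadingCoeff_ne_zero f hfc] at h4
      rw [map_mul, map_mul, h4, map_pow, map_pow, map_neg, map_one, smul_eq_mul, ← hc]
      have h5 : ((-1 : ℂ) ^ ((i : ℕ) + 1)) * (-1) ^ ((i : ℕ) + 1) = 1 := by
        rw [← mul_pow]; simp
      linear_combination (f c ^ ((i : ℕ) + 1) * (P.map f).roots.esymm (i + 1)) * h5
    simp only [h3]
    exact (map_aeval_int (MvPolynomial.aeval (R := ℤ) w).toRingHom _ (q k)).symm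
  have hcardw : ((P.map e).aroots ℂ).toFinset.card = (Finset.univ.image w).card := by
    rw [hmap, ← hz]
    have : Finset.univ.image w = (Finset.univ.image z).image (fun x => f c * x) := by
      rw [Finset.image_image]; rfl
    rw [this, Finset.card_image_of_injective _ (mul_right_injective₀ hfc)]
    rfl
  have key' : ∀ k, e (MvPolynomial.aeval
      (fun i : Fin d => (-1) ^ ((i : ℕ) + 1) * c ^ (i : ℕ) * P.coeff (d - (i + 1))) (q k)) ≠ 0 ↔
      subdisc w k ≠ 0 := by
    intro k
    rw [← key k, hf, RingHom.comp_apply]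
    simp
  simp only [key', hcardw]
  exact ⟨subdisc_ne_zero w, fun k hk => not_lt.mp fun hlt => hk (subdisc_eq_zero w hlt)⟩

end DistinctRoots

end ConicStructure

namespace ConicStructure

section GenericCoordinates

lemma prod_pow_line {A ι : Type*} [CommRing A] (u a : ι → A) (m : ι → ℕ) (s : Finset ι) :
    (∏ i ∈ s, (Polynomial.C (u i) + Polynomial.C (a i) * Polynomial.X) ^ m i).natDegree
        ≤ ∑ i ∈ s, m i ∧
      (∏ i ∈ s, (Polynomial.C (u i) + Polynomial.C (a i) * Polynomial.X) ^ m i).coeff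
        (∑ i ∈ s, m i) = ∏ i ∈ s, a i ^ m i := by
  classical
  induction s using Finset.induction_on with
  | empty => simp
  | insert j s hj ih =>
    have h1 : (Polynomial.C (u j) + Polynomial.C (a j) * Polynomial.X).natDegree ≤ 1 := by
      compute_degree
    have h2 : ((Polynomial.C (u j) + Polynomial.C (a j) * Polynomial.X) ^ m j).natDegree ≤ m j := by
      simpa using Polynomial.natDegree_pow_le_of_le (m j) h1
    have h3 : ((Polynomial.C (u j) + Polynomial.C (a j) * Polynomial.X) ^ m j).coeff (m j)
        = a j ^ m j := by
      have := Polynomial.coeff_pow_of_natDegree_le (m := m j) h1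
      rw [mul_one] at this
      rw [this]
      simp
    rw [Finset.prod_insert hj, Finset.sum_insert hj, Finset.prod_insert hj]
    exact ⟨Polynomial.natDegree_mul_le_of_le h2 ih.1, by
      rw [Polynomial.coeff_mul_add_eq_of_natDegree_le h2 ih.1, h3, ih.2]⟩

variable {R : Type*} [CommRing R]

/-- Substitution of the parametrised line `u + a X` into a multivariate polynomial. -/
lemma aeval_line {σ A : Type*} [Fintype σ] [CommRing A] [Algebra R A] (u : σ → A) (a : σ → R)
    (f : MvPolynomial σ R) :
    (MvPolynomial.aeval (fun i => Polynomial.C (u i) +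
        Polynomial.C (algebraMap R A (a i)) * Polynomial.X) f).natDegree ≤ f.totalDegree ∧
      (MvPolynomial.aeval (fun i => Polynomial.C (u i) +
        Polynomial.C (algebraMap R A (a i)) * Polynomial.X) f).coeff f.totalDegree =
      algebraMap R A (MvPolynomial.eval a
        (MvPolynomial.homogeneousComponent f.totalDegree f)) := by
  classical
  rw [MvPolynomial.aeval_def, MvPolynomial.eval₂_eq']
  have hdeg : ∀ m ∈ f.support, ∑ i, m i ≤ f.totalDegree := by
    intro m hm
    have := MvPolynomial.le_totalDegree hm
    rwa [Finsupp.sum_fintype _ _ (fun _ => rfl)] at this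
  have halg : ∀ r : R, algebraMap R (Polynomial A) r = Polynomial.C (algebraMap R A r) :=
    fun r => rfl
  constructor
  · refine Polynomial.natDegree_sum_le_of_forall_le _ _ fun m hm => ?_
    rw [halg]
    exact (Polynomial.natDegree_C_mul_le _ _).trans
      ((prod_pow_line u _ m Finset.univ).1.trans (hdeg m hm))
  · rw [Polynomial.finsetSum_coeff, MvPolynomial.homogeneousComponent_apply, map_sum, map_sum,
      Finset.sum_filter]
    refine Finset.sum_congr rfl fun m hm => ?_
    obtain ⟨h1, h2⟩ := prod_pow_line u (fun i => algebraMap R A (a i)) m Finset.univ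
    rw [halg, Polynomial.coeff_C_mul, Finsupp.degree_eq_sum]
    split_ifs with h
    · rw [← h, h2, MvPolynomial.eval_monomial, Finsupp.prod_fintype _ _ (fun _ => pow_zero _),
        map_mul, map_prod]
      simp
    · rw [Polynomial.coeff_eq_zero_of_natDegree_lt, mul_zero]
      exact lt_of_le_of_lt h1 (lt_of_le_of_ne (hdeg m hm) h)

lemma homogeneousComponent_totalDegree_ne_zero {σ : Type*} {f : MvPolynomial σ R} (hf : f ≠ 0) :
    MvPolynomial.homogeneousComponent f.totalDegree f ≠ 0 := by
  obtain ⟨m, hm, hmd⟩ := Finset.exists_mem_eq_sup f.support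
    (MvPolynomial.support_nonempty.mpr hf) (fun s => s.sum fun _ e => e)
  intro h
  have := congrArg (MvPolynomial.coeff m) h
  rw [MvPolynomial.coeff_homogeneousComponent, MvPolynomial.coeff_zero, if_pos] at this
  · exact MvPolynomial.mem_support_iff.mp hm this
  · rw [MvPolynomial.totalDegree, hmd]
    rfl

lemma exists_generic_direction {n : ℕ} [IsDomain R] [Infinite R]
    (F : Finset (MvPolynomial (Fin (n + 1)) R)) : ∃ a : Fin (n + 1) → R, a 0 ≠ 0 ∧ ∀ f ∈ F, f ≠ 0 →
      MvPolynomial.eval a (MvPolynomial.homogeneousComponent f.totalDegree f) ≠ 0 := by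
  classical
  set g : MvPolynomial (Fin (n + 1)) R := MvPolynomial.X 0 * ∏ f ∈ F.filter (· ≠ 0),
    MvPolynomial.homogeneousComponent f.totalDegree f with hg
  have hg0 : g ≠ 0 := by
    refine mul_ne_zero (MvPolynomial.X_ne_zero 0) (Finset.prod_ne_zero_iff.mpr fun f hf => ?_)
    exact homogeneousComponent_totalDegree_ne_zero (Finset.mem_filter.mp hf).2
  obtain ⟨a, ha⟩ : ∃ a, MvPolynomial.eval a g ≠ 0 := by
    by_contra! h
    exact hg0 (MvPolynomial.funext fun a => by rw [h a, map_zero])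
  rw [hg, map_mul, map_prod, MvPolynomial.eval_X] at ha
  refine ⟨a, left_ne_zero_of_mul ha, fun f hf hf0 => ?_⟩
  exact Finset.prod_ne_zero_iff.mp (right_ne_zero_of_mul ha) f (Finset.mem_filter.mpr ⟨hf, hf0⟩)

end GenericCoordinates

section LeadingConstant

open Polynomial

variable {n : ℕ}

/-- The leading coefficient does not depend on the variables (only on time). -/
def HasConstLead (g : Polynomial (MvPolynomial (Fin n) ℝ[X])) : Prop :=
  ∃ c : ℝ[X], c ≠ 0 ∧ g.leadingCoeff = MvPolynomial.C c

lemma HasConstLead.derivative {g : Polynomial (MvPolynomial (Fin n) ℝ[X])} (h : HasConstLead g)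
    (hd : g.natDegree ≠ 0) :
    HasConstLead (Polynomial.derivative g) ∧ (Polynomial.derivative g).natDegree = g.natDegree - 1 := by
  obtain ⟨c, hc, hg⟩ := h
  have hdeg : (Polynomial.derivative g).natDegree = g.natDegree - 1 := by
    refine le_antisymm (natDegree_derivative_le g) (le_natDegree_of_ne_zero ?_)
    rw [coeff_derivative, Nat.sub_add_cancel (Nat.pos_of_ne_zero hd), coeff_natDegree, hg]
    refine mul_ne_zero ((map_ne_zero_iff _ (MvPolynomial.C_injective (Fin n) ℝ[X])).mpr hc) ?_
    exact_mod_cast Nat.succ_ne_zero (g.natDegree - 1)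
  refine ⟨⟨c * (g.natDegree : ℝ[X]), mul_ne_zero hc (Nat.cast_ne_zero.mpr hd), ?_⟩, hdeg⟩
  rw [leadingCoeff, hdeg, coeff_derivative, Nat.sub_add_cancel (Nat.pos_of_ne_zero hd),
    coeff_natDegree, hg, map_mul, map_natCast]
  congr 1
  rw [← Nat.cast_succ, Nat.succ_eq_add_one, Nat.sub_add_cancel (Nat.pos_of_ne_zero hd)]

lemma HasConstLead.iterate_derivative {g : Polynomial (MvPolynomial (Fin n) ℝ[X])}
    (h : HasConstLead g) {j : ℕ} (hj : j ≤ g.natDegree) :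
    HasConstLead (Polynomial.derivative^[j] g) ∧
      (Polynomial.derivative^[j] g).natDegree = g.natDegree - j := by
  induction j with
  | zero => exact ⟨h, rfl⟩
  | succ j ih =>
    obtain ⟨h1, h2⟩ := ih (by omega)
    rw [Function.iterate_succ_apply']
    have := h1.derivative (by omega)
    exact ⟨this.1, by rw [this.2, h2]; omega⟩

/-- Evaluation at time `t` and at the point `x`. -/
def evAt (t : ℝ) (x : Fin n → ℝ) : MvPolynomial (Fin n) ℝ[X] →+* ℝ :=
  MvPolynomial.eval₂Hom (Polynomial.evalRingHom t) x

@[simp] lemma evAt_C (t : ℝ) (x : Fin n → ℝ) (r : ℝ[X]) :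
    evAt t x (MvPolynomial.C r) = r.eval t := by
  simp [evAt]

@[simp] lemma evAt_X (t : ℝ) (x : Fin n → ℝ) (i : Fin n) : evAt t x (MvPolynomial.X i) = x i := by
  simp [evAt]

lemma continuous_evAt (f : MvPolynomial (Fin n) ℝ[X]) :
    Continuous fun z : ℝ × (Fin n → ℝ) => evAt z.1 z.2 f := by
  induction f using MvPolynomial.induction_on with
  | C r => simp only [evAt_C]; exact r.continuous.comp continuous_fst
  | add p q hp hq => simp only [map_add]; exact hp.add hq
  | mul_X p i hp => simp only [map_mul, evAt_X]; exact hp.mul ((continuous_apply i).comp continuous_snd)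

lemma natDegree_map_evAt {g : Polynomial (MvPolynomial (Fin n) ℝ[X])} {t : ℝ} {x : Fin n → ℝ}
    (h : evAt t x g.leadingCoeff ≠ 0) : (g.map (evAt t x)).natDegree = g.natDegree :=
  natDegree_map_of_leadingCoeff_ne_zero _ h

lemma eventually_forall_ge_eval_ne_zero {c : ℝ[X]} (hc : c ≠ 0) :
    ∀ᶠ T : ℝ in atTop, ∀ t, T ≤ t → c.eval t ≠ 0 :=
  eventually_forall_ge_atTop.mpr (Polynomial.eventually_atTop_not_isRoot c hc)

/-- The index type of the iterated derivatives of the members of a finite set of polynomials. -/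
abbrev DerivIndex (S : Finset (Polynomial (MvPolynomial (Fin n) ℝ[X]))) : Type :=
  Σ g : {g // g ∈ S}, Fin (g.1.natDegree + 1)

/-- The iterated derivatives of the members of a finite set of polynomials. -/
def derivFamily (S : Finset (Polynomial (MvPolynomial (Fin n) ℝ[X]))) (i : DerivIndex S) :
    Polynomial (MvPolynomial (Fin n) ℝ[X]) := Polynomial.derivative^[i.2] i.1.1

/-- The specialization of `derivFamily`. -/
def evFamily (T : ℝ) (S : Finset (Polynomial (MvPolynomial (Fin n) ℝ[X]))) (i : DerivIndex S)
    (w : ℝ × (Fin n → ℝ)) : ℝ[X] := (derivFamily S i).map (evAt (max T w.1) w.2)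

lemma rootFamily_evFamily {T : ℝ} {S : Finset (Polynomial (MvPolynomial (Fin n) ℝ[X]))}
    (hS : ∀ g ∈ S, HasConstLead g)
    (hT : ∀ i (w : ℝ × (Fin n → ℝ)), evAt (max T w.1) w.2 (derivFamily S i).leadingCoeff ≠ 0) :
    RootFamily (evFamily T S) where
  contPoly i := by
    have hdeg : ∀ w, (evFamily T S i w).natDegree = (derivFamily S i).natDegree :=
      fun w => natDegree_map_evAt (hT i w)
    refine ⟨fun m => ?_, ⟨_, hdeg⟩, fun w h0 => hT i w ?_⟩
    · simp only [evFamily, coeff_map]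
      exact (continuous_evAt _).comp (by fun_prop : Continuous fun w : ℝ × (Fin n → ℝ) =>
        (max T w.1, w.2))
    · have := congrArg (fun q => q.coeff (derivFamily S i).natDegree) h0
      simpa [evFamily] using this
  deriv := by
    rintro ⟨g, j⟩
    obtain ⟨h1, h2⟩ := (hS g.1 g.2).iterate_derivative (Nat.lt_succ_iff.mp j.2)
    by_cases hj : (j : ℕ) + 1 < g.1.natDegree + 1
    · refine Or.inr ⟨⟨g, ⟨j + 1, hj⟩⟩, fun w => ?_⟩
      simp only [evFamily, derivFamily, Function.iterate_succ_apply', derivative_map]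
    · refine Or.inl fun w => ?_
      rw [evFamily, natDegree_map_evAt (hT _ w), derivFamily, h2]
      have := j.2
      omega

end LeadingConstant

end ConicStructure

namespace ConicStructure

open Polynomial

lemma IsFlow.conj {E E' : Type*} [TopologicalSpace E] [TopologicalSpace E'] {G : ℝ → ℝ → E → E}
    (hG : IsFlow G) {φ : ℝ → E → E'} {ψ : ℝ → E' → E}
    (hφ : Continuous fun z : ℝ × E => φ z.1 z.2) (hψ : Continuous fun z : ℝ × E' => ψ z.1 z.2)
    (h1 : ∀ t x, ψ t (φ t x) = x) (h2 : ∀ t y, φ t (ψ t y) = y) :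
    IsFlow fun s t y => φ t (G s t (ψ s y)) where
  cont := by
    have hψ' : Continuous fun z : ℝ × ℝ × E' => ψ z.1 z.2.2 :=
      hψ.comp (by fun_prop : Continuous fun z : ℝ × ℝ × E' => (z.1, z.2.2))
    have hG' : Continuous fun z : ℝ × ℝ × E' => G z.1 z.2.1 (ψ z.1 z.2.2) :=
      hG.cont.comp (continuous_fst.prodMk ((continuous_fst.comp continuous_snd).prodMk hψ'))
    exact hφ.comp ((continuous_fst.comp continuous_snd).prodMk hG')
  self s y := by simp only [hG.self, h2]
  comp s t u y := by simp only [h1, hG.comp]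

lemma isFlow_const (E : Type*) [TopologicalSpace E] : IsFlow fun (_ _ : ℝ) (x : E) => x where
  cont := by fun_prop
  self _ _ := rfl
  comp _ _ _ _ := rfl

lemma sign_eval_eq_of_forall_ne_zero {r : ℝ[X]} {T s t : ℝ} (h : ∀ u, T ≤ u → r.eval u ≠ 0)
    (hs : T ≤ s) (ht : T ≤ t) : SignType.sign (r.eval s) = SignType.sign (r.eval t) := by
  rcases lt_or_gt_of_ne (h s hs) with h0 | h0
  · have := pos_of_pos_of_ne_zero (f := fun u => -r.eval u) r.continuous.neg isPreconnected_Ici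
      (fun u hu => neg_ne_zero.mpr (h u hu)) (mem_Ici.mpr hs) (mem_Ici.mpr ht) (by linarith)
    rw [sign_neg h0, sign_neg (by linarith)]
  · have := pos_of_pos_of_ne_zero r.continuous isPreconnected_Ici (fun u hu => h u hu)
      (mem_Ici.mpr hs) (mem_Ici.mpr ht) h0
    rw [sign_pos h0, sign_pos this]

section Line

variable {n : ℕ} (a : Fin (n + 1) → ℝ[X])

/-- The substitution turning a polynomial in `n + 1` variables into a univariate polynomial along
the direction `a`. -/
def lineSub : MvPolynomial (Fin (n + 1)) ℝ[X] →ₐ[ℝ[X]] Polynomial (MvPolynomial (Fin n) ℝ[X]) :=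
  MvPolynomial.aeval fun i =>
    C ((Fin.cons 0 MvPolynomial.X : Fin (n + 1) → MvPolynomial (Fin n) ℝ[X]) i) +
      C (algebraMap ℝ[X] (MvPolynomial (Fin n) ℝ[X]) (a i)) * X

/-- The linear change of coordinates at time `t` underlying `lineSub`. -/
def lineMap (t : ℝ) (z : ℝ × (Fin n → ℝ)) : Fin (n + 1) → ℝ :=
  fun i => (Fin.cons 0 z.2 : Fin (n + 1) → ℝ) i + (a i).eval t * z.1

/-- The inverse of `lineMap`. -/
def lineInv (t : ℝ) (v : Fin (n + 1) → ℝ) : ℝ × (Fin n → ℝ) :=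
  (v 0 / (a 0).eval t, fun i => v i.succ - (a i.succ).eval t * (v 0 / (a 0).eval t))

variable {a}

lemma lineInv_lineMap {t : ℝ} (h : (a 0).eval t ≠ 0) (z : ℝ × (Fin n → ℝ)) :
    lineInv a t (lineMap a t z) = z := by
  ext <;> simp [lineInv, lineMap, h]

lemma lineMap_lineInv {t : ℝ} (h : (a 0).eval t ≠ 0) (v : Fin (n + 1) → ℝ) :
    lineMap a t (lineInv a t v) = v := by
  ext i
  refine Fin.cases ?_ (fun i => ?_) i
  · simp only [lineMap, lineInv, Fin.cons_zero, zero_add]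
    field_simp
  · simp [lineMap, lineInv]

lemma continuous_lineMap : Continuous fun z : ℝ × (ℝ × (Fin n → ℝ)) => lineMap a z.1 z.2 := by
  refine continuous_pi fun i => ?_
  have h1 : Continuous fun z : ℝ × (ℝ × (Fin n → ℝ)) => (a i).eval z.1 * z.2.1 :=
    ((a i).continuous.comp continuous_fst).mul (by fun_prop)
  refine Continuous.add ?_ h1
  refine Fin.cases ?_ (fun i => ?_) i
  · simpa using continuous_const
  · simp only [Fin.cons_succ]
    fun_prop

lemma continuous_lineInv {f : ℝ → ℝ} (hf : Continuous f) (h : ∀ t, (a 0).eval (f t) ≠ 0) :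
    Continuous fun z : ℝ × (Fin (n + 1) → ℝ) => lineInv a (f z.1) z.2 := by
  have hev : ∀ i, Continuous fun z : ℝ × (Fin (n + 1) → ℝ) => (a i).eval (f z.1) := fun i =>
    (a i).continuous.comp (hf.comp continuous_fst)
  have h0 : Continuous fun z : ℝ × (Fin (n + 1) → ℝ) => z.2 0 / (a 0).eval (f z.1) :=
    Continuous.div (by fun_prop) (hev 0) fun z => h z.1
  exact h0.prodMk (continuous_pi fun i => Continuous.sub (by fun_prop) ((hev i.succ).mul h0))

lemma eval_map_lineSub (t : ℝ) (z : ℝ × (Fin n → ℝ)) (f : MvPolynomial (Fin (n + 1)) ℝ[X]) :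
    ((lineSub a f).map (evAt t z.2)).eval z.1 = evAt t (lineMap a t z) f := by
  have : ((Polynomial.evalRingHom z.1).comp (Polynomial.mapRingHom (evAt t z.2))).comp
      (lineSub a : MvPolynomial (Fin (n + 1)) ℝ[X] →+* _) = evAt t (lineMap a t z) := by
    refine MvPolynomial.ringHom_ext (fun r => ?_) fun i => ?_
    · have : algebraMap ℝ[X] (Polynomial (MvPolynomial (Fin n) ℝ[X])) r =
        C (MvPolynomial.C r) := rfl
      simp [lineSub, this]
    · refine Fin.cases ?_ (fun i => ?_) i <;>
        simp [lineSub, lineMap, MvPolynomial.algebraMap_eq]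
  exact RingHom.congr_fun this f

lemma hasConstLead_lineSub {f : MvPolynomial (Fin (n + 1)) ℝ[X]}
    (h : MvPolynomial.eval a (MvPolynomial.homogeneousComponent f.totalDegree f) ≠ 0) :
    HasConstLead (lineSub a f) := by
  obtain ⟨h1, h2⟩ := aeval_line
    (Fin.cons 0 MvPolynomial.X : Fin (n + 1) → MvPolynomial (Fin n) ℝ[X]) a f
  rw [MvPolynomial.algebraMap_eq] at h1 h2
  refine ⟨_, h, ?_⟩
  have hne : MvPolynomial.C (σ := Fin n) (MvPolynomial.eval a
      (MvPolynomial.homogeneousComponent f.totalDegree f)) ≠ 0 :=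
    (map_ne_zero_iff _ (MvPolynomial.C_injective (Fin n) ℝ[X])).mpr h
  have hd : (lineSub a f).natDegree = f.totalDegree :=
    le_antisymm h1 (le_natDegree_of_ne_zero (by rw [← h2] at hne; exact hne))
  rw [leadingCoeff, hd]
  exact h2

end Line

section Induction

variable {n : ℕ} {S : Finset (Polynomial (MvPolynomial (Fin n) ℝ[X]))}

lemma hasConstLead_derivFamily (hS : ∀ g ∈ S, HasConstLead g) (i : DerivIndex S) :
    HasConstLead (derivFamily S i) :=
  ((hS i.1.1 i.1.2).iterate_derivative (Nat.lt_succ_iff.mp i.2.2)).1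

lemma complexRoots_evFamily (T : ℝ) (w : ℝ × (Fin n → ℝ)) :
    complexRoots (evFamily T S) w =
      (((∏ i, derivFamily S i).map (evAt (max T w.1) w.2)).aroots ℂ).toFinset := by
  rw [complexRoots, Polynomial.map_prod]
  rfl

lemma exists_forall_card_complexRoots_eq {T : ℝ} {D : ℕ → MvPolynomial (Fin n) ℝ[X]}
    (hD : ∀ e : MvPolynomial (Fin n) ℝ[X] →+* ℝ, e (∏ i, derivFamily S i).leadingCoeff ≠ 0 →
      e (D (((∏ i, derivFamily S i).map e).aroots ℂ).toFinset.card) ≠ 0 ∧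
      ∀ k, e (D k) ≠ 0 → k ≤ (((∏ i, derivFamily S i).map e).aroots ℂ).toFinset.card)
    (hT : ∀ w : ℝ × (Fin n → ℝ), evAt (max T w.1) w.2 (∏ i, derivFamily S i).leadingCoeff ≠ 0)
    {G : ℝ → ℝ → (Fin n → ℝ) → (Fin n → ℝ)}
    (hG : ∀ k ≤ (∏ i, derivFamily S i).natDegree, ∀ s t x,
      SignType.sign (evAt (max T t) (G s t x) (D k)) = SignType.sign (evAt (max T s) x (D k)))
    (s : ℝ) (x : Fin n → ℝ) :
    ∃ N, ∀ u, (complexRoots (evFamily T S) (u, G s u x)).card = N := by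
  set N : ℝ → ℕ := fun u => (complexRoots (evFamily T S) (u, G s u x)).card with hN
  have hND : ∀ u, N u = (((∏ i, derivFamily S i).map
      (evAt (max T u) (G s u x))).aroots ℂ).toFinset.card := fun u => by
    rw [hN]
    simp only [complexRoots_evFamily]
  have hle : ∀ u, N u ≤ (∏ i, derivFamily S i).natDegree := fun u => by
    rw [hND]
    refine (Multiset.toFinset_card_le _).trans ((card_roots' _).trans ?_)
    exact (natDegree_map_le).trans natDegree_map_le
  have hmono : ∀ u u', N u ≤ N u' := by
    intro u u'
    have h1 := (hD (evAt (max T u) (G s u x)) (hT (u, G s u x))).1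
    rw [← hND] at h1
    have h2 := (hD (evAt (max T u') (G s u' x)) (hT (u', G s u' x))).2 (N u) ?_
    · rwa [← hND] at h2
    · rw [← sign_ne_zero] at h1 ⊢
      rwa [hG _ (hle u), ← hG _ (hle u) s u x]
  exact ⟨N 0, fun u => le_antisymm (hmono u 0) (hmono 0 u)⟩

/-- Every finite set of polynomials with coefficients depending polynomially on time admits, for
large times, a flow preserving all their signs. -/
theorem exists_flow (n : ℕ) (F : Finset (MvPolynomial (Fin n) ℝ[X])) :
    ∀ᶠ T : ℝ in atTop, ∃ G : ℝ → ℝ → (Fin n → ℝ) → (Fin n → ℝ), IsFlow G ∧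
      ∀ f ∈ F, ∀ s t x, SignType.sign (evAt (max T t) (G s t x) f) =
        SignType.sign (evAt (max T s) x f) := by
  classical
  induction n with
  | zero =>
    have hF : ∀ᶠ T : ℝ in atTop, ∀ f ∈ F, f ≠ 0 →
        ∀ t, T ≤ t → (MvPolynomial.isEmptyRingEquiv ℝ[X] (Fin 0) f).eval t ≠ 0 := by
      rw [Filter.eventually_all_finset]
      intro f _
      by_cases hf : f = 0
      · exact Eventually.of_forall fun T h => absurd hf h
      · filter_upwards [eventually_forall_ge_eval_ne_zero (c :=
          MvPolynomial.isEmptyRingEquiv ℝ[X] (Fin 0) f) 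
          ((map_ne_zero_iff _ (RingEquiv.injective _)).mpr hf)] with T hT _ using hT
    filter_upwards [hF] with T hT
    refine ⟨fun _ _ x => x, isFlow_const _, fun f hf s t x => ?_⟩
    by_cases hf0 : f = 0
    · simp [hf0]
    · have hev : ∀ t, evAt t x f = (MvPolynomial.isEmptyRingEquiv ℝ[X] (Fin 0) f).eval t := by
        intro t
        obtain ⟨r, rfl⟩ := MvPolynomial.C_surjective (Fin 0) f
        rw [evAt_C]
        congr 1
        exact ((MvPolynomial.isEmptyRingEquiv ℝ[X] (Fin 0)).apply_symm_apply r).symm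
      rw [hev, hev]
      exact sign_eval_eq_of_forall_ne_zero (hT f hf hf0) (le_max_left _ _) (le_max_left _ _)
  | succ n ih =>
    obtain ⟨a, ha0, ha⟩ := exists_generic_direction F
    set S : Finset (Polynomial (MvPolynomial (Fin n) ℝ[X])) :=
      insert X ((F.filter (· ≠ 0)).image (lineSub a)) with hS
    have hSX : (X : Polynomial (MvPolynomial (Fin n) ℝ[X])) ∈ S := Finset.mem_insert_self _ _
    have hlead : ∀ g ∈ S, HasConstLead g := by
      intro g hg
      rcases Finset.mem_insert.mp hg with rfl | hg
      · exact ⟨1, one_ne_zero, by rw [leadingCoeff_X, map_one]⟩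
      · obtain ⟨f, hf, rfl⟩ := Finset.mem_image.mp hg
        rw [Finset.mem_filter] at hf
        exact hasConstLead_lineSub (ha f hf.1 hf.2)
    obtain ⟨D, hD⟩ := exists_distinct_roots_detector (∏ i, derivFamily S i)
    have hc : ∀ i, ∃ c : ℝ[X], c ≠ 0 ∧ (derivFamily S i).leadingCoeff = MvPolynomial.C c :=
      hasConstLead_derivFamily hlead
    choose c hc0 hc using hc
    have hcT : ∀ᶠ T : ℝ in atTop, ∀ i, ∀ t, T ≤ t → (c i).eval t ≠ 0 :=
      Filter.eventually_all.mpr fun i => eventually_forall_ge_eval_ne_zero (hc0 i)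
    filter_upwards [hcT, eventually_forall_ge_eval_ne_zero ha0,
      ih ((Finset.range ((∏ i, derivFamily S i).natDegree + 1)).image D)] with T hT haT hGT
    obtain ⟨G, hG, hsign⟩ := hGT
    have hleadT : ∀ i (w : ℝ × (Fin n → ℝ)),
        evAt (max T w.1) w.2 (derivFamily S i).leadingCoeff ≠ 0 := by
      intro i w
      rw [hc, evAt_C]
      exact hT i _ (le_max_left _ _)
    have hN := exists_forall_card_complexRoots_eq hD (fun w => by
      rw [leadingCoeff_prod, map_prod]
      exact Finset.prod_ne_zero_iff.mpr fun i _ => hleadT i w) (G := G)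
      (fun k hk => hsign (D k) (Finset.mem_image_of_mem _
        (Finset.mem_range.mpr (Nat.lt_succ_of_le hk))))
    have hp : RootFamily (evFamily T S) := rootFamily_evFamily hlead hleadT
    have hne : ∀ w, (realRoots (evFamily T S) w).Nonempty := fun w =>
      ⟨0, hp.mem_realRoots.mpr ⟨⟨⟨X, hSX⟩, 0⟩, by simp [evFamily, derivFamily]⟩⟩
    have haT' : ∀ t, (a 0).eval (max T t) ≠ 0 := fun t => haT _ (le_max_left _ _)
    have hmax : Continuous fun t : ℝ => max T t := by fun_prop
    have hH := (isFlow_liftFlow hG hp hN hne).conj (φ := fun t => lineMap a (max T t))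
      (ψ := fun t => lineInv a (max T t))
      (continuous_lineMap.comp ((hmax.comp continuous_fst).prodMk continuous_snd))
      (continuous_lineInv hmax haT') (fun t => lineInv_lineMap (haT' t))
      (fun t => lineMap_lineInv (haT' t))
    refine ⟨_, hH, fun f hf s t v => ?_⟩
    by_cases hf0 : f = 0
    · simp [hf0]
    · have hfS : lineSub a f ∈ S := Finset.mem_insert_of_mem
        (Finset.mem_image_of_mem _ (Finset.mem_filter.mpr ⟨hf, hf0⟩))
      have := sign_liftFlow hG hp hN hne ⟨⟨_, hfS⟩, 0⟩ s t (lineInv a (max T s) v)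
      simp only [evFamily, derivFamily, Fin.val_zero, Function.iterate_zero, id,
        eval_map_lineSub, lineMap_lineInv (haT' s)] at this
      exact this

end Induction

end ConicStructure

namespace ConicStructure

section Semialgebraic

variable {n : ℕ}

lemma evAt_map_C (t : ℝ) (x : Fin n → ℝ) (p : MvPolynomial (Fin n) ℝ) :
    evAt t x (MvPolynomial.map Polynomial.C p) = MvPolynomial.eval x p := by
  have : (evAt t x).comp (MvPolynomial.map Polynomial.C) = MvPolynomial.eval x :=
    MvPolynomial.ringHom_ext (fun r => by simp) fun i => by simp
  exact RingHom.congr_fun this p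

/-- The polynomial vanishing at time `t` exactly on the sphere of radius `|t|`. -/
def spherePoly (n : ℕ) : MvPolynomial (Fin n) (Polynomial ℝ) :=
  ∑ i, MvPolynomial.X i ^ 2 - MvPolynomial.C (Polynomial.X ^ 2)

lemma evAt_spherePoly (t : ℝ) (x : EuclideanSpace ℝ (Fin n)) :
    evAt t x.ofLp (spherePoly n) = ‖x‖ ^ 2 - t ^ 2 := by
  simp [spherePoly, EuclideanSpace.real_norm_sq_eq]

/-- A semialgebraic set admits, for large times, a flow preserving it and carrying spheres about
the origin to one another. -/
lemma exists_flow_of_isSemialgebraic {C : Set (EuclideanSpace ℝ (Fin n))}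
    (hC : IsSemialgebraic C) :
    ∀ᶠ T : ℝ in atTop, ∃ G : ℝ → ℝ → EuclideanSpace ℝ (Fin n) → EuclideanSpace ℝ (Fin n),
      IsFlow G ∧ (∀ s t x, G s t x ∈ C ↔ x ∈ C) ∧
      ∀ s t x, T ≤ s → T ≤ t → ‖x‖ = s → ‖G s t x‖ = t := by
  classical
  obtain ⟨m, P, k, Q, rfl⟩ := hC
  set F : Finset (MvPolynomial (Fin n) (Polynomial ℝ)) := insert (spherePoly n)
    ((Finset.univ.image fun i => MvPolynomial.map Polynomial.C (P i)) ∪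
      Finset.univ.biUnion fun i =>
        Finset.univ.image fun l => MvPolynomial.map Polynomial.C (Q i l)) with hF
  filter_upwards [exists_flow n F, eventually_ge_atTop 0] with T ⟨G, hG, hsign⟩ hT0
  have hP : ∀ i s t x, SignType.sign (MvPolynomial.eval (G s t x) (P i)) =
      SignType.sign (MvPolynomial.eval x (P i)) := fun i s t x => by
    have := hsign (MvPolynomial.map Polynomial.C (P i)) (by simp [hF]) s t x
    rwa [evAt_map_C, evAt_map_C] at this
  have hQ : ∀ i l s t x, SignType.sign (MvPolynomial.eval (G s t x) (Q i l)) =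
      SignType.sign (MvPolynomial.eval x (Q i l)) := fun i l s t x => by
    have := hsign (MvPolynomial.map Polynomial.C (Q i l))
      (Finset.mem_insert_of_mem (Finset.mem_union_right _ (Finset.mem_biUnion.mpr
        ⟨i, Finset.mem_univ _, Finset.mem_image_of_mem _ (Finset.mem_univ l)⟩))) s t x
    rwa [evAt_map_C, evAt_map_C] at this
  refine ⟨_, hG.conj (φ := fun _ => WithLp.toLp 2)
    (ψ := fun _ (x : EuclideanSpace ℝ (Fin n)) => x.ofLp)
    ((PiLp.continuous_toLp 2 _).comp continuous_snd)
    ((PiLp.continuous_ofLp 2 _).comp continuous_snd)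
    (fun _ _ => rfl) (fun _ _ => rfl), fun s t x => ?_, fun s t x hs ht hx => ?_⟩
  · simp only [mem_iUnion, mem_ofPred_eq]
    refine exists_congr fun i => and_congr ?_ (forall_congr' fun l => ?_)
    · rw [← sign_eq_zero_iff, hP, sign_eq_zero_iff]
    · rw [← sign_eq_one_iff, hQ, sign_eq_one_iff]
  · have := hsign (spherePoly n) (Finset.mem_insert_self _ _) s t x.ofLp
    rw [max_eq_right hs, max_eq_right ht, evAt_spherePoly s x, hx, sub_self, sign_zero,
      sign_eq_zero_iff, evAt_spherePoly t (WithLp.toLp 2 (G s t x.ofLp))] at this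
    exact (pow_left_inj₀ (norm_nonneg _) (hT0.trans ht) two_ne_zero).mp (by linarith)

lemma exists_isHomeoOn_of_isFlow {E : Type*} [NormedAddCommGroup E] [NormedSpace ℝ E] {C : Set E}
    {R : ℝ} (hR : 0 < R) {G : ℝ → ℝ → E → E} (hG : IsFlow G)
    (hGC : ∀ s t x, G s t x ∈ C ↔ x ∈ C)
    (hGn : ∀ s t x, R ≤ s → R ≤ t → ‖x‖ = s → ‖G s t x‖ = t) :
    ∃ h : E → E, IsHomeoOn h (C \ Metric.ball 0 R) (coneInfSet (C ∩ Metric.sphere 0 R)) ∧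
      ∀ x ∈ C \ Metric.ball 0 R, ‖h x‖ = ‖x‖ := by
  set h : E → E := fun x => (‖x‖ / R) • G ‖x‖ R x with hh
  set g : E → E := fun y => G R ‖y‖ ((R / ‖y‖) • y) with hg
  have hnorm : ∀ x, R ≤ ‖x‖ → ‖h x‖ = ‖x‖ := fun x hx => by
    simp only [hh]
    rw [norm_smul, hGn _ _ x hx le_rfl rfl, Real.norm_of_nonneg (by positivity),
      div_mul_cancel₀ _ hR.ne']
  have hcone : ∀ y, y ∈ coneInfSet (C ∩ Metric.sphere 0 R) ↔
      R ≤ ‖y‖ ∧ (R / ‖y‖) • y ∈ C := by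
    intro y
    constructor
    · rintro ⟨a, ⟨haC, haR⟩, t, ht, rfl⟩
      rw [mem_sphere_zero_iff_norm] at haR
      have ht0 : 0 < t := by linarith
      have hn : ‖t • a‖ = t * R := by rw [norm_smul, haR, Real.norm_of_nonneg ht0.le]
      refine ⟨by rw [hn]; nlinarith, ?_⟩
      rw [hn, smul_smul, show R / (t * R) * t = 1 by field_simp, one_smul]
      exact haC
    · rintro ⟨hy, hyC⟩
      have hy0 : 0 < ‖y‖ := hR.trans_le hy
      refine ⟨_, ⟨hyC, ?_⟩, ‖y‖ / R, (one_le_div hR).mpr hy, ?_⟩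
      · rw [mem_sphere_zero_iff_norm, norm_smul, Real.norm_of_nonneg (by positivity),
          div_mul_cancel₀ _ hy0.ne']
      · rw [smul_smul, show ‖y‖ / R * (R / ‖y‖) = 1 by field_simp, one_smul]
  have hdom : ∀ x, x ∈ C \ Metric.ball 0 R ↔ x ∈ C ∧ R ≤ ‖x‖ := fun x => by
    simp [Set.mem_sdiff]
  have hscale : ∀ x, R ≤ ‖x‖ → (R / ‖h x‖) • h x = G ‖x‖ R x := fun x hx => by
    have hx0 : 0 < ‖x‖ := hR.trans_le hx
    rw [hnorm x hx, hh, smul_smul, show R / ‖x‖ * (‖x‖ / R) = 1 by field_simp, one_smul]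
  have hgn : ∀ y, R ≤ ‖y‖ → ‖g y‖ = ‖y‖ := fun y hy => by
    have hy0 : 0 < ‖y‖ := hR.trans_le hy
    refine hGn _ _ _ le_rfl hy ?_
    rw [norm_smul, Real.norm_of_nonneg (by positivity), div_mul_cancel₀ _ hy0.ne']
  have hgh : ∀ x ∈ C \ Metric.ball 0 R, g (h x) = x := fun x hx => by
    have hx := ((hdom x).mp hx).2
    simp only [hg]
    rw [hscale x hx, hnorm x hx, hG.comp, hG.self]
  have hhg : ∀ y ∈ coneInfSet (C ∩ Metric.sphere 0 R), h (g y) = y := fun y hy => by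
    have hy := ((hcone y).mp hy).1
    have hy0 : 0 < ‖y‖ := hR.trans_le hy
    simp only [hh]
    rw [hgn y hy, hg, hG.comp, hG.self, smul_smul, show ‖y‖ / R * (R / ‖y‖) = 1 by field_simp,
      one_smul]
  have hmaps : MapsTo h (C \ Metric.ball 0 R) (coneInfSet (C ∩ Metric.sphere 0 R)) := by
    intro x hx
    obtain ⟨hxC, hx⟩ := (hdom x).mp hx
    rw [hcone, hscale x hx, hnorm x hx]
    exact ⟨hx, (hGC _ _ _).mpr hxC⟩
  have gmaps : MapsTo g (coneInfSet (C ∩ Metric.sphere 0 R)) (C \ Metric.ball 0 R) := by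
    intro y hy
    obtain ⟨hy, hyC⟩ := (hcone y).mp hy
    rw [hdom, hgn y hy]
    exact ⟨(hGC _ _ _).mpr hyC, hy⟩
  refine ⟨h, ⟨InvOn.bijOn ⟨hgh, hhg⟩ hmaps gmaps, ?_, g, hgh, hhg, ?_⟩,
    fun x hx => hnorm x ((hdom x).mp hx).2⟩
  · refine Continuous.continuousOn ?_
    exact (continuous_norm.div_const R).smul (hG.cont.comp
      (by fun_prop : Continuous fun x : E => (‖x‖, R, x)))
  · refine hG.cont.comp_continuousOn (f := fun y : E => (R, ‖y‖, (R / ‖y‖) • y))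
      (continuousOn_const.prodMk (continuous_norm.continuousOn.prodMk
        ((continuousOn_const.div continuous_norm.continuousOn fun y hy => ?_).smul
          continuousOn_id)))
    exact (hR.trans_le ((hcone y).mp hy).1).ne'

end Semialgebraic

end ConicStructure

/-- conic structure at infinity of semialgebraic sets. -/
theorem conic_structure_at_infinity {n : ℕ} (C : Set (EuclideanSpace ℝ (Fin n)))
    (hC : IsSemialgebraic C) (hCu : ¬ Bornology.IsBounded C) :
    ∃ R₀ : ℝ, 0 < R₀ ∧ ∀ R, R₀ ≤ R →
      ∃ h : EuclideanSpace ℝ (Fin n) → EuclideanSpace ℝ (Fin n),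
        IsHomeoOn h (C \ Metric.ball 0 R) (coneInfSet (C ∩ Metric.sphere 0 R)) ∧
        ∀ x ∈ C \ Metric.ball 0 R, ‖h x‖ = ‖x‖ := by
  obtain ⟨R₀, hR₀⟩ :=
    eventually_atTop.mp (ConicStructure.exists_flow_of_isSemialgebraic hC)
  refine ⟨max R₀ 1, by positivity, fun R hR => ?_⟩
  obtain ⟨G, hG, hGC, hGn⟩ := hR₀ R ((le_max_left _ _).trans hR)
  exact ConicStructure.exists_isHomeoOn_of_isFlow
    (zero_lt_one.trans_le ((le_max_right _ _).trans hR)) hG hGC hGn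

end
end

section
/- Let V = {(x,y) ∈ ℝ² : y = |x|}. Then the map φ : ℝ → V given by φ(x) = (x, |x|) is a blow-spherical homeomorphism, i.e., φ is a homeomorphism and is a blow-spherical homeomorphism at every p ∈ ℝ ∪ {∞}. -/
open Filter Set Topology

noncomputable section

section ClosedExtension

/-- A continuous injective map on `closure S`, proper by a linear growth bound, is a
homeomorphism from `closure S` onto the closure of the image of `S`. -/
theorem isHomeoOn_closure {α β : Type*} [NormedAddCommGroup α] [NormedAddCommGroup β]
    [ProperSpace α] [ProperSpace β] {S : Set α} {G : α → β} {C D : ℝ}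
    (hc : ContinuousOn G (closure S)) (hi : InjOn G (closure S)) (hC : 0 < C)
    (hG : ∀ z ∈ closure S, ‖z‖ ≤ C * ‖G z‖ + D) :
    IsHomeoOn G (closure S) (closure (G '' S)) := by
  set g : closure S → β := (closure S).domRestrict G with hg
  have hgc : Continuous g := hc.domRestrict
  have hgi : Function.Injective g := hi.injective
  have hproper : IsProperMap g := by
    refine isProperMap_iff_tendsto_cocompact.2 ⟨hgc, ?_⟩
    have hval : Tendsto (fun z : closure S => ‖(z : α)‖) (cocompact _) atTop :=
      (tendsto_norm_cocompact_atTop (E := α)).comp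
        isClosed_closure.isClosedEmbedding_subtypeVal.tendsto_cocompact
    rw [← Metric.cobounded_eq_cocompact (α := β), ← tendsto_norm_atTop_iff_cobounded]
    refine tendsto_atTop_mono (fun z => ?_)
      ((tendsto_atTop_add_const_right _ (-D) hval).const_mul_atTop (inv_pos.2 hC))
    rw [inv_mul_le_iff₀ hC]
    have := hG z z.2
    simp only [hg, Set.domRestrict_apply]
    linarith
  have hemb : IsClosedEmbedding g :=
    .of_continuous_injective_isClosedMap hgc hgi hproper.isClosedMap
  have hrange : range g = closure (G '' S) := by
    rw [hg, Set.range_domRestrict]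
    refine (hc.image_closure).antisymm (closure_minimal (image_mono subset_closure) ?_)
    rw [← Set.range_domRestrict]
    exact hemb.isClosed_range
  have himage : G '' closure S = closure (G '' S) := by rw [← hrange, hg, Set.range_domRestrict]
  refine ⟨himage ▸ hi.bijOn_image, hc, Function.invFunOn G (closure S),
    hi.leftInvOn_invFunOn, ?_, ?_⟩
  · intro y hy
    rw [← himage] at hy
    exact Function.invFunOn_eq hy
  · rw [continuousOn_iff_continuous_domRestrict]
    have key : ∀ y : closure (G '' S), (closure (G '' S)).domRestrict
        (Function.invFunOn G (closure S)) y =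
          hemb.isEmbedding.toHomeomorph.symm ⟨y, hrange.symm ▸ y.2⟩ := by
      rintro ⟨y, hy⟩
      obtain ⟨z, rfl⟩ : y ∈ range g := hrange.symm ▸ hy
      have : hemb.isEmbedding.toHomeomorph.symm ⟨g z, hrange.symm ▸ hy⟩ = z :=
        hemb.isEmbedding.toHomeomorph.symm_apply_eq.2 (Subtype.ext rfl)
      simp only [this]
      exact hi.leftInvOn_invFunOn z.2
    rw [show (closure (G '' S)).domRestrict (Function.invFunOn G (closure S)) = _ from funext key]
    fun_prop

end ClosedExtension

section BlowupCriterion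

variable {E F : Type*} [NormedAddCommGroup E] [NormedSpace ℝ E]
  [NormedAddCommGroup F] [NormedSpace ℝ F]

theorem strictTransformO_eq (X : Set E) (po : Option E) :
    strictTransformO X po = closure (blowupInvO po '' {x ∈ X | ¬ IsCenter po x}) := by
  cases po <;> rfl

/-- A homeomorphism is blow-spherical at `po` as soon as the induced map between strict transforms
is the restriction of a continuous, injective map of linear growth. -/
theorem isBSHomeoAtO_of_extension [ProperSpace E] [ProperSpace F] {h : E → F} {X : Set E}
    {Y : Set F} {po : Option E} {qo : Option F} (hh : IsHomeoOn h X Y) (hlim : BSLimit h X po qo)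
    (hcenter : ∀ x ∈ X, IsCenter qo (h x) ↔ IsCenter po x) {G : E × ℝ → F × ℝ} {C D : ℝ}
    (hc : ContinuousOn G (strictTransformO X po)) (hi : InjOn G (strictTransformO X po))
    (hC : 0 < C) (hG : ∀ z ∈ strictTransformO X po, ‖z‖ ≤ C * ‖G z‖ + D)
    (hcomm : ∀ x ∈ X, ¬ IsCenter po x → G (blowupInvO po x) = blowupInvO qo (h x)) :
    IsBSHomeoAtO h X Y po qo := by
  refine ⟨hh, hlim, G, ?_, fun x hx hpx _ => hcomm x hx hpx⟩
  have himage : blowupInvO qo '' {y ∈ Y | ¬ IsCenter qo y} =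
      G '' (blowupInvO po '' {x ∈ X | ¬ IsCenter po x}) := by
    have hY : {y ∈ Y | ¬ IsCenter qo y} = h '' {x ∈ X | ¬ IsCenter po x} := by
      ext y
      constructor
      · rintro ⟨hy, hqy⟩
        obtain ⟨x, hx, rfl⟩ := hh.1.surjOn hy
        exact ⟨x, ⟨hx, fun hpx => hqy ((hcenter x hx).2 hpx)⟩, rfl⟩
      · rintro ⟨x, ⟨hx, hpx⟩, rfl⟩
        exact ⟨hh.1.mapsTo hx, fun hqy => hpx ((hcenter x hx).1 hqy)⟩
    rw [hY, image_image, image_image]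
    exact image_congr fun x hx => (hcomm x hx.1 hx.2).symm
  rw [strictTransformO_eq] at hc hi hG ⊢
  rw [strictTransformO_eq, himage]
  exact isHomeoOn_closure hc hi hC hG

end BlowupCriterion

section AbsGraph

/-- The strict transform of the line at any point lies in the union of two half-lines. -/
theorem strictTransformO_univ_subset (po : Option ℝ) :
    strictTransformO univ po ⊆ {z : ℝ × ℝ | |z.1| = 1 ∧ 0 ≤ z.2} := by
  have hclosed : IsClosed {z : ℝ × ℝ | |z.1| = 1 ∧ 0 ≤ z.2} :=
    (isClosed_eq (by fun_prop) continuous_const).inter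
      (isClosed_le continuous_const continuous_snd)
  rw [strictTransformO_eq]
  refine closure_minimal ?_ hclosed
  rintro _ ⟨x, ⟨-, hx⟩, rfl⟩
  cases po with
  | none =>
    have : |x| ≠ 0 := abs_ne_zero.2 hx
    simp [blowupInvO, blowupInvInf, abs_mul, abs_inv, this]
  | some p =>
    have : |x - p| ≠ 0 := abs_ne_zero.2 (sub_ne_zero.2 hx)
    simp [blowupInvO, blowupInv, abs_mul, abs_inv, this]

/-- The extension to the strict transform of `x ↦ (x, f x)`, where `k (u, r)` is the slope of `f`
along the ray `u`, and `w` rescales the radius. -/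
def slopeLift (k : ℝ × ℝ → ℝ) (w : ℝ → ℝ) (z : ℝ × ℝ) : EuclideanSpace ℝ (Fin 2) × ℝ :=
  (‖!₂[z.1, k z]‖⁻¹ • !₂[z.1, k z], z.2 * w ‖!₂[z.1, k z]‖)

variable {k : ℝ × ℝ → ℝ} {w : ℝ → ℝ} {T : Set (ℝ × ℝ)}

theorem one_le_norm_pair {a : ℝ} (ha : |a| = 1) (b : ℝ) : 1 ≤ ‖!₂[a, b]‖ := by
  simpa [ha] using PiLp.norm_apply_le !₂[a, b] 0

theorem continuousOn_slopeLift (hT : ∀ z ∈ T, |z.1| = 1) (hk : ContinuousOn k T)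
    (hw : ContinuousOn w (Ici 1)) : ContinuousOn (slopeLift k w) T := by
  have hv : ContinuousOn (fun z : ℝ × ℝ => !₂[z.1, k z]) T := by
    refine (PiLp.continuous_toLp 2 _).comp_continuousOn (continuousOn_pi.2 fun i => ?_)
    fin_cases i
    · exact continuousOn_fst
    · exact hk
  have hn : ∀ z ∈ T, 1 ≤ ‖!₂[z.1, k z]‖ := fun z hz => one_le_norm_pair (hT z hz) _
  exact ((hv.norm.inv₀ fun z hz => (one_pos.trans_le (hn z hz)).ne').smul hv).prodMk
    (continuousOn_snd.mul (hw.comp hv.norm hn))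

theorem injOn_slopeLift (hT : ∀ z ∈ T, |z.1| = 1) (hw : ∀ t, 1 ≤ t → 0 < w t) :
    InjOn (slopeLift k w) T := by
  rintro ⟨a, r⟩ hz ⟨b, s⟩ hz' heq
  have hn := one_le_norm_pair (hT _ hz) (k (a, r))
  have hn' := one_le_norm_pair (hT _ hz') (k (b, s))
  obtain ⟨h1, h2⟩ := Prod.ext_iff.1 heq
  have h0 := congrArg (fun v : EuclideanSpace ℝ (Fin 2) => v 0) h1
  simp only [slopeLift, PiLp.smul_apply, smul_eq_mul] at h0 h2 hn hn'
  have hw' := hw _ hn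
  generalize ‖!₂[a, k (a, r)]‖ = N at *
  generalize ‖!₂[b, k (b, s)]‖ = M at *
  simp only [Matrix.cons_val_zero] at h0
  have hN : 0 < N := by linarith
  have hM : 0 < M := by linarith
  have hNM : N = M := by
    have := congrArg abs h0
    simp only [abs_mul, abs_inv, hT _ hz, hT _ hz', mul_one, abs_of_pos hN, abs_of_pos hM] at this
    exact inv_injective this
  subst hNM
  exact Prod.ext (mul_left_cancel₀ (inv_pos.2 hN).ne' h0) (mul_right_cancel₀ hw'.ne' h2)

theorem norm_le_slopeLift {c : ℝ} (hc : 0 < c) {z : ℝ × ℝ} (hz : |z.1| = 1)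
    (hw : c ≤ w ‖!₂[z.1, k z]‖) : ‖z‖ ≤ c⁻¹ * ‖slopeLift k w z‖ + 1 := by
  have h2 : c * |z.2| ≤ ‖slopeLift k w z‖ := by
    refine le_trans ?_ (norm_snd_le _)
    rw [slopeLift, Real.norm_eq_abs, abs_mul, mul_comm]
    exact mul_le_mul_of_nonneg_left (hw.trans (le_abs_self _)) (abs_nonneg _)
  have h3 : |z.2| ≤ c⁻¹ * ‖slopeLift k w z‖ := by rwa [le_inv_mul_iff₀ hc]
  rw [Prod.norm_def, Real.norm_eq_abs, Real.norm_eq_abs, hz]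
  exact max_le (by linarith [abs_nonneg z.2]) (by linarith)

theorem isHomeoOn_abs_graph :
    IsHomeoOn (fun x : ℝ => (!₂[x, |x|] : EuclideanSpace ℝ (Fin 2))) univ
      {p : EuclideanSpace ℝ (Fin 2) | p 1 = |p 0|} := by
  have hcont : Continuous fun x : ℝ => (!₂[x, |x|] : EuclideanSpace ℝ (Fin 2)) := by
    refine (PiLp.continuous_toLp 2 _).comp (continuous_pi fun i => ?_)
    fin_cases i
    · exact continuous_id
    · exact continuous_abs
  have hright : ∀ y ∈ {p : EuclideanSpace ℝ (Fin 2) | p 1 = |p 0|}, !₂[y 0, |y 0|] = y := by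
    intro y hy
    ext i
    fin_cases i
    · rfl
    · exact hy.symm
  exact ⟨⟨fun x _ => rfl, fun x _ y _ hxy => congrArg (fun v : EuclideanSpace ℝ (Fin 2) => v 0) hxy,
      fun y hy => ⟨y 0, mem_univ _, hright y hy⟩⟩, hcont.continuousOn, fun v => v 0,
    fun x _ => rfl, hright, by fun_prop⟩

/-- The slopes of `|·|` at `p` extend continuously to the two half-lines over `p`. -/
theorem exists_slope_abs (p : ℝ) :
    ∃ k : ℝ × ℝ → ℝ, ContinuousOn k {z | |z.1| = 1 ∧ 0 ≤ z.2} ∧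
      ∀ x, x ≠ p → |x - p| * k (blowupInv p x) = |x| - |p| := by
  rcases eq_or_ne p 0 with rfl | hp
  · exact ⟨fun _ => 1, continuousOn_const, fun x _ => by simp⟩
  · refine ⟨fun z => z.1 * dslope (fun t : ℝ => |t|) p (p + z.1 * z.2), ?_, fun x hx => ?_⟩
    · have hd : Continuous (dslope (fun t : ℝ => |t|) p) :=
        continuous_iff_continuousAt.2 fun t => by
          rcases eq_or_ne t p with rfl | ht
          · exact continuousAt_dslope_same.2 (differentiableAt_abs hp)
          · exact (continuousAt_dslope_of_ne ht).2 continuous_abs.continuousAt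
      fun_prop
    · have hxp : |x - p| ≠ 0 := abs_ne_zero.2 (sub_ne_zero.2 hx)
      have hadd : p + |x - p|⁻¹ * (x - p) * |x - p| = x := by field_simp; ring
      have := sub_smul_dslope (fun t : ℝ => |t|) p x
      simp only [blowupInv, Real.norm_eq_abs, smul_eq_mul] at this ⊢
      rw [hadd, ← this]
      field_simp

theorem isBSHomeoAtO_abs_graph_point (p : ℝ) :
    IsBSHomeoAtO (fun x : ℝ => (!₂[x, |x|] : EuclideanSpace ℝ (Fin 2))) univ
      {p : EuclideanSpace ℝ (Fin 2) | p 1 = |p 0|} (some p) (some !₂[p, |p|]) := by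
  obtain ⟨k, hk, hkx⟩ := exists_slope_abs p
  have hsub := strictTransformO_univ_subset (some p)
  refine isBSHomeoAtO_of_extension (G := slopeLift k id) isHomeoOn_abs_graph ?_ ?_
    (continuousOn_slopeLift (fun z hz => (hsub hz).1) (hk.mono hsub) continuousOn_id)
    (injOn_slopeLift (fun z hz => (hsub hz).1) fun t ht => one_pos.trans_le ht)
    (inv_pos.2 one_pos)
    (fun z hz => norm_le_slopeLift one_pos (hsub hz).1 (one_le_norm_pair (hsub hz).1 _)) ?_
  · exact isHomeoOn_abs_graph.2.1 p (mem_univ p)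
  · intro x _
    exact ⟨fun h => congrArg (fun v : EuclideanSpace ℝ (Fin 2) => v 0) h, fun h => by
      simp only [IsCenter] at h ⊢; rw [h]⟩
  · intro x _ hx
    have hr : 0 < |x - p| := abs_pos.2 (sub_ne_zero.2 hx)
    have hv : !₂[x, |x|] - !₂[p, |p|] =
        |x - p| • !₂[(blowupInv p x).1, k (blowupInv p x)] := by
      ext i
      fin_cases i
      · simp [blowupInv, hr.ne']
      · simpa using (hkx x hx).symm
    simp only [blowupInvO, slopeLift]
    rw [blowupInv.eq_def !₂[p, |p|], hv, norm_smul, Real.norm_eq_abs, abs_abs]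
    refine Prod.ext ?_ rfl
    simp only [smul_smul]
    congr 1
    field_simp

theorem isBSHomeoAtO_abs_graph_infty :
    IsBSHomeoAtO (fun x : ℝ => (!₂[x, |x|] : EuclideanSpace ℝ (Fin 2))) univ
      {p : EuclideanSpace ℝ (Fin 2) | p 1 = |p 0|} none none := by
  have hsub := strictTransformO_univ_subset none
  have hnorm : ∀ z ∈ strictTransformO univ (none : Option ℝ),
      (√2)⁻¹ ≤ ‖!₂[z.1, (1 : ℝ)]‖⁻¹ := by
    intro z hz
    have hsq : z.1 ^ 2 = 1 := by rw [← sq_abs, (hsub hz).1, one_pow]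
    simp [EuclideanSpace.norm_eq, hsq, one_add_one_eq_two]
  refine isBSHomeoAtO_of_extension (G := slopeLift (fun _ => 1) (·⁻¹)) isHomeoOn_abs_graph ?_ ?_
    (continuousOn_slopeLift (fun z hz => (hsub hz).1) continuousOn_const
      (continuousOn_id.inv₀ fun t ht => (one_pos.trans_le ht).ne'))
    (injOn_slopeLift (fun z hz => (hsub hz).1) fun t ht => inv_pos.2 (one_pos.trans_le ht))
    (by positivity)
    (fun z hz => norm_le_slopeLift (by positivity) (hsub hz).1 (hnorm z hz)) ?_
  · refine tendsto_atTop_mono (fun x => ?_) (tendsto_comap.mono_left inf_le_left)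
    exact PiLp.norm_apply_le !₂[x, |x|] 0
  · intro x _
    exact ⟨fun h => congrArg (fun v : EuclideanSpace ℝ (Fin 2) => v 0) h, fun h => by
      simp only [IsCenter] at h ⊢; ext i; fin_cases i <;> simp [h]⟩
  · intro x _ hx
    have hr : 0 < |x| := abs_pos.2 hx
    have hv : !₂[x, |x|] = |x| • !₂[(blowupInvInf x).1, (1 : ℝ)] := by
      ext i
      fin_cases i
      · simp [blowupInvInf, hr.ne']
      · simp
    simp only [blowupInvO, slopeLift]
    rw [blowupInvInf.eq_def !₂[x, |x|], hv, norm_smul, Real.norm_eq_abs, abs_abs]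
    refine Prod.ext ?_ ?_
    · simp only [smul_smul]
      congr 1
      field_simp
    · simp [blowupInvInf, mul_comm]

end AbsGraph

/-- the map `x ↦ (x, |x|)` is a blow-spherical homeomorphism from `ℝ` onto
`V = {(x, y) ∈ ℝ² : y = |x|}`. -/
theorem abs_graph_bs_homeo :
    IsBSHomeo (fun x : ℝ => ((WithLp.equiv 2 (Fin 2 → ℝ)).symm ![x, |x|] :
        EuclideanSpace ℝ (Fin 2)))
      (Set.univ : Set ℝ) {p : EuclideanSpace ℝ (Fin 2) | p 1 = |p 0|} := by
  exact ⟨isHomeoOn_abs_graph, fun p _ => ⟨_, isBSHomeoAtO_abs_graph_point p⟩,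
    _, isBSHomeoAtO_abs_graph_infty⟩

end
end
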